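/- Under the standing assumptions, and with E_0 a constant as specified, there exists L_1 > 0 such that for every natural number L > L_1 and every ε > 0, limsup_{n→∞} #BAD_{L,ε}(n) / #B_S(n) ≤ 5·ε·(2E_0 + 4LF_0 + 5)·#B_S(E_0 + 2LF_0)·#B_S(F_0·L + 4). -/

import Mathlib

namespace AcylCount

/-! ### Geodesic segments and Gromov hyperbolicity -/

/-- A finite geodesic segment in a metric space, parametrized by arclength on `[0, len]`,
oriented from `initial := toFun 0` to `terminal := toFun len`. -/
structure GeodesicSegment (X : Type*) [MetricSpace X] where
  len : ℝ
  len_nonneg : 0 ≤ len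
  toFun : ℝ → X
  isom : ∀ s ∈ Set.Icc (0:ℝ) len, ∀ t ∈ Set.Icc (0:ℝ) len,
    dist (toFun s) (toFun t) = |s - t|

namespace GeodesicSegment

variable {X : Type*} [MetricSpace X]

/-- The initial point of a geodesic segment. -/
def initial (γ : GeodesicSegment X) : X := γ.toFun 0

/-- The terminal point of a geodesic segment. -/
def terminal (γ : GeodesicSegment X) : X := γ.toFun γ.len

/-- The image (underlying set) of a geodesic segment. -/
def seg (γ : GeodesicSegment X) : Set X := γ.toFun '' Set.Icc 0 γ.len

/-- The translate of a geodesic segment by an isometry. -/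
def translate (γ : GeodesicSegment X) (f : X → X) (hf : Isometry f) :
    GeodesicSegment X where
  len := γ.len
  len_nonneg := γ.len_nonneg
  toFun := f ∘ γ.toFun
  isom := fun s hs t ht => by
    simp only [Function.comp_apply, hf.dist_eq]
    exact γ.isom s hs t ht

/-- The degenerate geodesic segment consisting of a single point. -/
def point (p : X) : GeodesicSegment X where
  len := 0
  len_nonneg := le_refl 0
  toFun := fun _ => p
  isom := fun s hs t ht => by
    have hs0 : s = 0 := le_antisymm hs.2 hs.1
    have ht0 : t = 0 := le_antisymm ht.2 ht.1
    simp [hs0, ht0]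

/-- `η` is a subsegment of `γ`. -/
def IsSubsegment (η γ : GeodesicSegment X) : Prop :=
  ∃ a b : ℝ, 0 ≤ a ∧ a ≤ b ∧ b ≤ γ.len ∧ η.len = b - a ∧
    ∀ t ∈ Set.Icc (0:ℝ) η.len, η.toFun t = γ.toFun (a + t)

/-- `p` occurs (weakly) before `q` along the oriented geodesic segment `γ`. -/
def Before (γ : GeodesicSegment X) (p q : X) : Prop :=
  ∃ s t : ℝ, s ∈ Set.Icc (0:ℝ) γ.len ∧ t ∈ Set.Icc (0:ℝ) γ.len ∧ s ≤ t ∧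
    γ.toFun s = p ∧ γ.toFun t = q

end GeodesicSegment

/-- A geodesic metric space: every two points are joined by a geodesic segment. -/
def IsGeodesicSpace (X : Type*) [MetricSpace X] : Prop :=
  ∀ x y : X, ∃ γ : GeodesicSegment X, γ.initial = x ∧ γ.terminal = y

/-- δ-hyperbolicity via slim triangles: each side of a geodesic triangle lies in the
closed δ-neighborhood of the union of the other two sides. -/
def IsDeltaHyperbolic (X : Type*) [MetricSpace X] (δ : ℝ) : Prop :=
  ∀ γ₁ γ₂ γ₃ : GeodesicSegment X,
    γ₁.initial = γ₃.initial → γ₁.terminal = γ₂.initial → γ₂.terminal = γ₃.terminal →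
    γ₃.seg ⊆ Metric.cthickening δ (γ₁.seg ∪ γ₂.seg)

variable {X : Type*} [MetricSpace X]

/-- The closest point projection of `x` to (the image of) the geodesic `γ`. -/
def proj (γ : GeodesicSegment X) (x : X) : Set X :=
  {p | p ∈ γ.seg ∧ dist x p = Metric.infDist x γ.seg}

/-- The closest point projection of a set `A` to the geodesic `γ`. -/
def projSet (γ : GeodesicSegment X) (A : Set X) : Set X :=
  ⋃ a ∈ A, proj γ a

/-- The ordered pair of oriented geodesic segments `(γ, η)` is `K`-aligned. -/
def AlignedPair (K : ℝ) (γ η : GeodesicSegment X) : Prop :=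
  Metric.diam (projSet γ η.seg ∪ {γ.terminal}) < K ∧
  Metric.diam (projSet η γ.seg ∪ {η.initial}) < K

/-- A sequence of oriented geodesic segments is `K`-aligned if each consecutive
pair is `K`-aligned. -/
def AlignedSeq (K : ℝ) (l : List (GeodesicSegment X)) : Prop :=
  l.Chain' (AlignedPair K)

/-- The Gromov product `(y, z)_x`. -/
noncomputable def gromovProd (x y z : X) : ℝ := (dist y x + dist x z - dist y z) / 2

/-! ### Word metric -/

variable {G : Type*} [Group G]

/-- The word length of `g` with respect to the (symmetrized) generating set `S`. -/
noncomputable def wordLength (S : Finset G) (g : G) : ℕ :=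
  sInf {n | ∃ l : List G, l.length = n ∧ (∀ x ∈ l, x ∈ S ∨ x⁻¹ ∈ S) ∧ l.prod = g}

/-- The word metric on `G` with respect to `S`. -/
noncomputable def wordDist (S : Finset G) (g h : G) : ℕ := wordLength S (g⁻¹ * h)

/-- The ball of radius `r` in the word metric, centered at the identity. -/
def ball (S : Finset G) (r : ℝ) : Set G := {g | (wordLength S g : ℝ) ≤ r}

/-- `G` has no cyclic subgroup of finite index. -/
def NonVirtuallyCyclic (G : Type*) [Group G] : Prop :=
  ¬ ∃ H : Subgroup G, H.FiniteIndex ∧ IsCyclic H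

/-! ### Isometric actions, loxodromics, WPD -/

/-- `g` is a loxodromic isometry for the action `ρ` with basepoint `x0`: the asymptotic
translation length `τ_X(g) = lim dist x0 (g^n x0) / n` exists and is positive. -/
def IsLoxodromic (ρ : G → X → X) (x0 : X) (g : G) : Prop :=
  ∃ τ : ℝ, 0 < τ ∧
    Filter.Tendsto (fun n : ℕ => dist x0 (ρ (g ^ n) x0) / n) Filter.atTop (nhds τ)

/-- The WPD (weak proper discontinuity) property of `g` for the action `ρ` with
basepoint `x0`. -/
def HasWPD (ρ : G → X → X) (x0 : X) (g : G) : Prop :=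
  ∀ K : ℝ, 0 < K → ∃ N M : ℕ,
    {h : G | dist x0 (ρ h x0) < K ∧ dist (ρ (g ^ N) x0) (ρ h (ρ (g ^ N) x0)) < K}.Finite ∧
    {h : G | dist x0 (ρ h x0) < K ∧ dist (ρ (g ^ N) x0) (ρ h (ρ (g ^ N) x0)) < K}.ncard < M

/-- The list of translated geodesics `h 1 • Υ, …, h m • Υ`. -/
def transList (ρ : G → X → X) (hisom : ∀ g : G, Isometry (ρ g))
    (Υ : GeodesicSegment X) (h : ℕ → G) (m : ℕ) : List (GeodesicSegment X) :=
  (List.range m).map fun i => Υ.translate (ρ (h (i + 1))) (hisom _)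

/-- The specification of the constant `E₀` from Fact 2.7 (Bestvina–Fujiwara):
(i) Gromov product bounds, (ii) the WPD-type conclusion for large projections. -/
def E0Spec (S : Finset G) (ρ : G → X → X) (x0 : X) (φ : G) (E0 : ℝ) : Prop :=
  0 < E0 ∧
  (∀ g : G, ∃ s t : G, (s ∈ S ∨ s = 1) ∧ (t ∈ S ∨ t = 1) ∧
    (∀ i : ℤ, 0 < i → gromovProd x0 (ρ (φ ^ i) x0) (ρ (s * g) x0) ≤ E0) ∧
    (∀ j : ℤ, j < 0 → gromovProd x0 (ρ (φ ^ j) x0) (ρ (t * g) x0) ≤ E0)) ∧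
  (∀ n : ℕ, 0 < n → ∀ g : G, ∀ γ : GeodesicSegment X,
    γ.initial = x0 → γ.terminal = ρ (φ ^ n) x0 →
    ∀ p ∈ proj γ (ρ g x0), ∀ q ∈ proj γ (ρ (g * φ ^ n) x0),
      γ.Before p q → E0 < dist p q →
      ∃ i j : ℕ, i ≤ n ∧ j ≤ n ∧ (wordDist S (φ ^ i) (g * φ ^ j) : ℝ) < E0)

/-- The set `V_{L,ε}(n)`. Here `Υ` is the chosen geodesic `Υ_L = [x₀, φ^L x₀]`. -/
def Vset (S : Finset G) (ρ : G → X → X) (hisom : ∀ g : G, Isometry (ρ g)) (x0 : X)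
    (δ E0 : ℝ) (Υ : GeodesicSegment X) (ε : ℝ) (n : ℕ) : Set G :=
  {g | g ∈ ball S (n:ℝ) ∧ ∃ h : ℕ → G,
    AlignedSeq (6 * E0 + 300 * δ)
      ([GeodesicSegment.point x0] ++ transList ρ hisom Υ h ⌈ε * (n:ℝ)⌉₊ ++
        [GeodesicSegment.point (ρ g x0)])}

/-- The set `W_{L,ε}(n)`. Here `Υ` is the chosen geodesic `Υ_L = [x₀, φ^L x₀]`. -/
def Wset (S : Finset G) (ρ : G → X → X) (hisom : ∀ g : G, Isometry (ρ g)) (x0 : X)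
    (δ E0 : ℝ) (Υ : GeodesicSegment X) (ε : ℝ) (n : ℕ) : Set G :=
  {g | g ∈ ball S (n:ℝ) ∧ ∃ h : ℕ → G,
    AlignedSeq (6 * E0 + 360 * δ)
      ([GeodesicSegment.point x0] ++ transList ρ hisom Υ h ⌈ε * (n:ℝ)⌉₊ ++
        [GeodesicSegment.point (ρ g x0)]) ∧
    AlignedPair (6 * E0 + 360 * δ) (GeodesicSegment.point (ρ g⁻¹ x0))
      (Υ.translate (ρ (h 1)) (hisom _)) ∧
    AlignedPair (6 * E0 + 360 * δ) (Υ.translate (ρ (h ⌈ε * (n:ℝ)⌉₊)) (hisom _))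
      (GeodesicSegment.point (ρ (g ^ 2) x0))}

/-- The set `BAD_{L,ε}(n)`. -/
def BADset (S : Finset G) (ρ : G → X → X) (hisom : ∀ g : G, Isometry (ρ g)) (x0 : X)
    (δ E0 : ℝ) (Υ : GeodesicSegment X) (ε : ℝ) (n : ℕ) : Set G :=
  ball S (n:ℝ) \ (ball S ((⌊(0.9:ℝ) * (n:ℝ)⌋₊ : ℕ) : ℝ) ∪ Vset S ρ hisom x0 δ E0 Υ ε n)

/-! ### Paths in the word metric -/

/-- `P` is a `d_S`-path connecting `a` to `b`. -/
noncomputable def IsPathFrom (S : Finset G) (P : List G) (a b : G) : Prop :=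
  P ≠ [] ∧ P.Chain' (fun u v => wordDist S u v = 1) ∧ P.head? = some a ∧ P.getLast? = some b

/-- The distance `d_S(P, g)` from a path `P` to a group element `g`. -/
noncomputable def pathDist (S : Finset G) (P : List G) (g : G) : ℕ :=
  sInf {d | ∃ v ∈ P, d = wordDist S v g}

/-! ### Elementary properties of the word length -/

theorem exists_word {S : Finset G} (hS : Subgroup.closure (S : Set G) = ⊤) (g : G) :
    ∃ l : List G, (∀ x ∈ l, x ∈ S ∨ x⁻¹ ∈ S) ∧ l.prod = g := by
  have hg : g ∈ Subgroup.closure (S : Set G) := by rw [hS]; trivial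
  rw [← Subgroup.mem_toSubmonoid, Subgroup.closure_toSubmonoid] at hg
  obtain ⟨l, hl, hp⟩ := Submonoid.exists_list_of_mem_closure hg
  refine ⟨l, fun x hx => ?_, hp⟩
  have := hl x hx
  simpa using this

theorem wordLength_le_length {S : Finset G} (l : List G) (hl : ∀ x ∈ l, x ∈ S ∨ x⁻¹ ∈ S) :
    wordLength S l.prod ≤ l.length :=
  Nat.sInf_le ⟨l, rfl, hl, rfl⟩

theorem exists_minimal_word {S : Finset G} (hS : Subgroup.closure (S : Set G) = ⊤) (g : G) :
    ∃ l : List G, l.length = wordLength S g ∧ (∀ x ∈ l, x ∈ S ∨ x⁻¹ ∈ S) ∧ l.prod = g := by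
  obtain ⟨l, hl, hp⟩ := exists_word hS g
  have hne : {n | ∃ l : List G, l.length = n ∧ (∀ x ∈ l, x ∈ S ∨ x⁻¹ ∈ S) ∧ l.prod = g}.Nonempty :=
    ⟨l.length, l, rfl, hl, hp⟩
  exact Nat.sInf_mem hne

theorem wordLength_one (S : Finset G) : wordLength S (1 : G) = 0 := by
  have := wordLength_le_length (S := S) [] (by simp)
  simpa using this

theorem wordLength_le_one {S : Finset G} {s : G} (hs : s ∈ S ∨ s = 1) : wordLength S s ≤ 1 := by
  rcases hs with hs | rfl
  · have := wordLength_le_length (S := S) [s] (by simp [hs])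
    simpa using this
  · simp [wordLength_one]

theorem wordLength_mul_le {S : Finset G} (hS : Subgroup.closure (S : Set G) = ⊤) (g h : G) :
    wordLength S (g * h) ≤ wordLength S g + wordLength S h := by
  obtain ⟨l, hl, hl', rfl⟩ := exists_minimal_word hS g
  obtain ⟨k, hk, hk', rfl⟩ := exists_minimal_word hS h
  rw [← hl, ← hk, ← List.prod_append, ← List.length_append]
  apply wordLength_le_length
  intro x hx
  rcases List.mem_append.1 hx with h | h
  exacts [hl' x h, hk' x h]

theorem wordLength_inv_le {S : Finset G} (hS : Subgroup.closure (S : Set G) = ⊤) (g : G) :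
    wordLength S g⁻¹ ≤ wordLength S g := by
  obtain ⟨l, hl, hl', rfl⟩ := exists_minimal_word hS g
  rw [← hl, List.prod_inv_reverse]
  refine (wordLength_le_length _ ?_).trans_eq (by simp)
  intro x hx
  simp only [List.mem_reverse, List.mem_map] at hx
  obtain ⟨y, hy, rfl⟩ := hx
  have := hl' y hy
  rw [inv_inv]
  exact this.symm

theorem wordLength_inv {S : Finset G} (hS : Subgroup.closure (S : Set G) = ⊤) (g : G) :
    wordLength S g⁻¹ = wordLength S g :=
  le_antisymm (wordLength_inv_le hS g) (by simpa using wordLength_inv_le hS g⁻¹)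

theorem wordLength_pow_le {S : Finset G} (hS : Subgroup.closure (S : Set G) = ⊤) (g : G) (k : ℕ) :
    wordLength S (g ^ k) ≤ k * wordLength S g := by
  induction k with
  | zero => simp [wordLength_one]
  | succ k ih =>
    rw [pow_succ, Nat.succ_mul]
    exact (wordLength_mul_le hS _ _).trans (Nat.add_le_add_right ih _)

theorem exists_split {S : Finset G} (hS : Subgroup.closure (S : Set G) = ⊤) (g : G) {i : ℕ}
    (hi : i ≤ wordLength S g) :
    ∃ a b : G, a * b = g ∧ wordLength S a = i ∧ wordLength S b = wordLength S g - i := by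
  obtain ⟨l, hl, hl', hp⟩ := exists_minimal_word hS g
  have hab : (l.take i).prod * (l.drop i).prod = g := by rw [List.prod_take_mul_prod_drop, hp]
  have h1 : wordLength S (l.take i).prod ≤ i :=
    (wordLength_le_length _ fun x hx => hl' x (List.mem_of_mem_take hx)).trans (by simp)
  have h2 : wordLength S (l.drop i).prod ≤ wordLength S g - i :=
    (wordLength_le_length _ fun x hx => hl' x (List.mem_of_mem_drop hx)).trans (by simp [hl])
  have h3 := wordLength_mul_le hS (l.take i).prod (l.drop i).prod
  rw [hab] at h3
  exact ⟨_, _, hab, by omega, by omega⟩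

theorem mem_ball_natCast {S : Finset G} {g : G} {n : ℕ} : g ∈ ball S (n : ℝ) ↔ wordLength S g ≤ n := by
  simp [ball]

theorem finite_ball_natCast {S : Finset G} (hS : Subgroup.closure (S : Set G) = ⊤) (n : ℕ) :
    (ball S (n : ℝ)).Finite := by
  have h0 : ∀ g : G, wordLength S g = 0 → g = 1 := by
    intro g hg
    obtain ⟨l, hl, -, rfl⟩ := exists_minimal_word hS g
    rw [hg, List.length_eq_zero_iff] at hl
    simp [hl]
  have h1 : {g : G | wordLength S g = 1}.Finite := by
    refine (S.finite_toSet.union S.finite_toSet.inv).subset ?_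
    intro g hg
    obtain ⟨l, hl, hl', rfl⟩ := exists_minimal_word hS g
    rw [hg, List.length_eq_one_iff] at hl
    obtain ⟨x, rfl⟩ := hl
    simpa using hl'
  induction n with
  | zero =>
    refine (Set.finite_singleton (1 : G)).subset fun g hg => h0 g ?_
    have := mem_ball_natCast.1 hg
    omega
  | succ n ih =>
    refine ((ih.mul h1).union ih).subset fun g hg => ?_
    have hg' := mem_ball_natCast.1 hg
    rcases Nat.lt_or_ge n (wordLength S g) with hn | hn
    · obtain ⟨a, b, hab, ha, hb⟩ := exists_split hS g hn.le
      left
      exact ⟨a, mem_ball_natCast.2 ha.le, b, by show wordLength S b = 1; omega, hab⟩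
    · right
      exact mem_ball_natCast.2 hn

theorem finite_ball {S : Finset G} (hS : Subgroup.closure (S : Set G) = ⊤) (r : ℝ) :
    (ball S r).Finite :=
  (finite_ball_natCast hS ⌈r⌉₊).subset fun _ hg => le_trans hg (Nat.le_ceil r)

theorem one_mem_ball (S : Finset G) {r : ℝ} (hr : 0 ≤ r) : (1 : G) ∈ ball S r := by
  simp [ball, wordLength_one, hr]

theorem one_le_ncard_ball {S : Finset G} (hS : Subgroup.closure (S : Set G) = ⊤) {r : ℝ}
    (hr : 0 ≤ r) : 1 ≤ (ball S r).ncard :=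
  (Set.ncard_pos (finite_ball hS r)).2 ⟨1, one_mem_ball S hr⟩

theorem ncard_ball_mono {S : Finset G} (hS : Subgroup.closure (S : Set G) = ⊤) {r s : ℝ}
    (h : r ≤ s) : (ball S r).ncard ≤ (ball S s).ncard :=
  Set.ncard_le_ncard (fun _ hg => le_trans hg h) (finite_ball hS s)

theorem ncard_ball_add_le {S : Finset G} (hS : Subgroup.closure (S : Set G) = ⊤) (p q : ℕ) :
    (ball S ((p + q : ℕ) : ℝ)).ncard ≤ (ball S (p : ℝ)).ncard * (ball S (q : ℝ)).ncard := by
  have hsub : ball S ((p + q : ℕ) : ℝ) ⊆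
      (fun x : G × G => x.1 * x.2) '' (ball S (p : ℝ) ×ˢ ball S (q : ℝ)) := by
    intro g hg
    have hg' := mem_ball_natCast.1 hg
    obtain ⟨a, b, hab, ha, hb⟩ := exists_split hS g (Nat.min_le_left (wordLength S g) p)
    exact ⟨(a, b), ⟨mem_ball_natCast.2 (by dsimp only; omega),
      mem_ball_natCast.2 (by dsimp only; omega)⟩, hab⟩
  have hfin := (finite_ball hS (p : ℝ)).prod (finite_ball hS (q : ℝ))
  refine (Set.ncard_le_ncard hsub (hfin.image _)).trans ((Set.ncard_image_le hfin).trans ?_)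
  rw [Set.ncard_prod]

/-- If subsets of `H` whose elements are pairwise `R`-far apart have at most `N` elements, then `H`
is covered by `N` balls of radius `R`. -/
theorem finite_and_ncard_le_of_separated {S : Finset G} (hS : Subgroup.closure (S : Set G) = ⊤)
    (R : ℝ) (hR : 0 ≤ R) (H : Set G) (N : ℕ)
    (hsep : ∀ T : Finset G, (T : Set G) ⊆ H →
      (∀ a ∈ T, ∀ b ∈ T, a ≠ b → R < wordLength S (a⁻¹ * b)) → T.card ≤ N) :
    H.Finite ∧ H.ncard ≤ N * (ball S R).ncard := by
  classical
  let P : ℕ → Prop := fun k => ∃ T : Finset G, (T : Set G) ⊆ H ∧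
      (∀ a ∈ T, ∀ b ∈ T, a ≠ b → R < wordLength S (a⁻¹ * b)) ∧ T.card = k
  have hP0 : P 0 := ⟨∅, by simp, by simp, rfl⟩
  obtain ⟨T, hTH, hTs, hTc⟩ := Nat.findGreatest_spec (P := P) (Nat.zero_le N) hP0
  have hcov : H ⊆ (fun x : G × G => x.1 * x.2) '' ((T : Set G) ×ˢ ball S R) := by
    intro h hh
    by_contra hcon
    have hfar : ∀ t ∈ T, R < wordLength S (t⁻¹ * h) := by
      intro t ht
      by_contra hle
      exact hcon ⟨(t, t⁻¹ * h), ⟨ht, not_lt.1 hle⟩, by simp⟩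
    have hhT : h ∉ T := by
      intro hT
      have := hfar h hT
      rw [inv_mul_cancel, wordLength_one] at this
      simp only [Nat.cast_zero] at this
      linarith
    have hP : P (T.card + 1) := by
      refine ⟨insert h T, ?_, ?_, Finset.card_insert_of_notMem hhT⟩
      · rw [Finset.coe_insert]
        exact Set.insert_subset hh hTH
      · intro a ha b hb hab
        rcases Finset.mem_insert.1 ha with rfl | ha' <;> rcases Finset.mem_insert.1 hb with rfl | hb'
        · exact absurd rfl hab
        · have := hfar b hb'
          rw [← wordLength_inv hS, mul_inv_rev, inv_inv] at this
          exact this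
        · exact hfar a ha'
        · exact hTs a ha' b hb' hab
    have hle : T.card + 1 ≤ N := by
      obtain ⟨T', h1, h2, h3⟩ := hP
      exact h3 ▸ hsep T' h1 h2
    have := Nat.le_findGreatest hle hP
    omega
  have hfin := T.finite_toSet.prod (finite_ball hS R)
  refine ⟨(hfin.image _).subset hcov, ?_⟩
  refine (Set.ncard_le_ncard hcov (hfin.image _)).trans ((Set.ncard_image_le hfin).trans ?_)
  rw [Set.ncard_prod, Set.ncard_coe_finset]
  exact Nat.mul_le_mul_right _ (hsep T hTH hTs)

/-! ### Gromov products in hyperbolic spaces -/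

namespace GeodesicSegment

theorem dist_initial_toFun (γ : GeodesicSegment X) {t : ℝ} (ht : t ∈ Set.Icc 0 γ.len) :
    dist γ.initial (γ.toFun t) = t := by
  rw [initial, γ.isom 0 ⟨le_rfl, γ.len_nonneg⟩ t ht, zero_sub, abs_neg, abs_of_nonneg ht.1]

theorem dist_toFun_terminal (γ : GeodesicSegment X) {t : ℝ} (ht : t ∈ Set.Icc 0 γ.len) :
    dist (γ.toFun t) γ.terminal = γ.len - t := by
  rw [terminal, γ.isom t ht _ ⟨γ.len_nonneg, le_rfl⟩, abs_sub_comm,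
    abs_of_nonneg (sub_nonneg.2 ht.2)]

theorem dist_initial_terminal (γ : GeodesicSegment X) : dist γ.initial γ.terminal = γ.len :=
  γ.dist_initial_toFun ⟨γ.len_nonneg, le_rfl⟩

theorem dist_add_dist (γ : GeodesicSegment X) {p : X} (hp : p ∈ γ.seg) :
    dist γ.initial p + dist p γ.terminal = dist γ.initial γ.terminal := by
  obtain ⟨t, ht, rfl⟩ := hp
  rw [γ.dist_initial_toFun ht, γ.dist_toFun_terminal ht, γ.dist_initial_terminal]
  ring

theorem isCompact_seg (γ : GeodesicSegment X) : IsCompact γ.seg := by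
  refine isCompact_Icc.image_of_continuousOn ?_
  refine LipschitzOnWith.continuousOn (K := 1) (LipschitzOnWith.of_dist_le_mul fun s hs t ht => ?_)
  rw [γ.isom s hs t ht, NNReal.coe_one, one_mul, Real.dist_eq]

theorem initial_mem_seg (γ : GeodesicSegment X) : γ.initial ∈ γ.seg :=
  ⟨0, ⟨le_rfl, γ.len_nonneg⟩, rfl⟩

theorem terminal_mem_seg (γ : GeodesicSegment X) : γ.terminal ∈ γ.seg :=
  ⟨γ.len, ⟨γ.len_nonneg, le_rfl⟩, rfl⟩

theorem before_of_dist_le (γ : GeodesicSegment X) {p q : X} (hp : p ∈ γ.seg) (hq : q ∈ γ.seg)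
    (h : dist γ.initial p ≤ dist γ.initial q) : γ.Before p q := by
  obtain ⟨s, hs, rfl⟩ := hp
  obtain ⟨t, ht, rfl⟩ := hq
  rw [γ.dist_initial_toFun hs, γ.dist_initial_toFun ht] at h
  exact ⟨s, t, hs, ht, h, rfl, rfl⟩

end GeodesicSegment

theorem proj_nonempty (γ : GeodesicSegment X) (x : X) : (proj γ x).Nonempty := by
  obtain ⟨p, hp, h⟩ := γ.isCompact_seg.exists_infDist_eq_dist ⟨_, γ.initial_mem_seg⟩ x
  exact ⟨p, hp, h.symm⟩

theorem gromovProd_comm (w x y : X) : gromovProd w x y = gromovProd w y x := by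
  simp only [gromovProd, dist_comm]
  ring

theorem gromovProd_nonneg (w x y : X) : 0 ≤ gromovProd w x y := by
  have := dist_triangle x w y
  unfold gromovProd
  linarith

theorem gromovProd_add (x y w : X) : gromovProd x w y + gromovProd w x y = dist x w := by
  simp only [gromovProd, dist_comm]
  ring

theorem gromovProd_map {f : X → X} (hf : Isometry f) (w x y : X) :
    gromovProd (f w) (f x) (f y) = gromovProd w x y := by
  simp only [gromovProd, hf.dist_eq]

theorem gromovProd_le_dist (γ : GeodesicSegment X) (w : X) {p : X} (hp : p ∈ γ.seg) :
    gromovProd w γ.initial γ.terminal ≤ dist w p := by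
  have h := γ.dist_add_dist hp
  have h1 := dist_triangle γ.initial p w
  have h2 := dist_triangle w p γ.terminal
  rw [dist_comm p w] at h1
  unfold gromovProd
  linarith

/-- The four-point form of hyperbolicity. -/
def FourPoint (X : Type*) [MetricSpace X] (θ : ℝ) : Prop :=
  ∀ w x y z : X, gromovProd w x z ≤ gromovProd w x y + θ ∨ gromovProd w z y ≤ gromovProd w x y + θ

section Hyperbolic

variable {δ : ℝ}

theorem IsDeltaHyperbolic.exists_near (hhyp : IsDeltaHyperbolic X δ) (hδ : 0 < δ)
    {γ₁ γ₂ γ₃ : GeodesicSegment X} (h₁ : γ₁.initial = γ₃.initial) (h₂ : γ₁.terminal = γ₂.initial)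
    (h₃ : γ₂.terminal = γ₃.terminal) {p : X} (hp : p ∈ γ₃.seg) :
    (∃ q ∈ γ₁.seg, dist p q ≤ 2 * δ) ∨ ∃ q ∈ γ₂.seg, dist p q ≤ 2 * δ := by
  have h := Metric.cthickening_subset_thickening' (by linarith) (by linarith : δ < 2 * δ) _
    (hhyp γ₁ γ₂ γ₃ h₁ h₂ h₃ hp)
  obtain ⟨q, hq, hd⟩ := Metric.mem_thickening_iff.1 h
  exact hq.imp (fun h => ⟨q, h, hd.le⟩) (fun h => ⟨q, h, hd.le⟩)

theorem exists_dist_le_gromovProd (hhyp : IsDeltaHyperbolic X δ) (hδ : 0 < δ)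
    (hgeo : IsGeodesicSpace X) (γ : GeodesicSegment X) (w : X) :
    ∃ p ∈ γ.seg, dist w p ≤ gromovProd w γ.initial γ.terminal + 4 * δ := by
  obtain ⟨γ₁, h1, h1'⟩ := hgeo γ.initial w
  obtain ⟨γ₂, h2, h2'⟩ := hgeo w γ.terminal
  have ht : gromovProd γ.initial w γ.terminal ∈ Set.Icc 0 γ.len := by
    refine ⟨gromovProd_nonneg _ _ _, ?_⟩
    rw [← γ.dist_initial_terminal]
    have := dist_triangle w γ.terminal γ.initial
    rw [dist_comm γ.terminal] at this
    have h3 := dist_triangle w γ.initial γ.terminal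
    have h4 := gromovProd_nonneg γ.terminal w γ.initial
    rw [← gromovProd_add γ.initial w γ.terminal, gromovProd_comm γ.initial _ w]
    rw [gromovProd_comm] at h4
    linarith
  have ha := γ.dist_initial_toFun ht
  have hb := γ.dist_toFun_terminal ht
  rw [← γ.dist_initial_terminal] at hb
  refine ⟨_, ⟨_, ht, rfl⟩, ?_⟩
  set p := γ.toFun (gromovProd γ.initial w γ.terminal)
  rcases hhyp.exists_near hδ h1 (h1'.trans h2.symm) h2' (p := p) ⟨_, ht, rfl⟩ with
    ⟨q, hq, hd⟩ | ⟨q, hq, hd⟩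
  · have h3 := γ₁.dist_add_dist hq
    rw [h1, h1'] at h3
    have h4 := dist_triangle w q p
    have h5 := dist_triangle γ.initial q p
    have h6 := gromovProd_add γ.initial γ.terminal w
    rw [dist_comm q p, dist_comm w q] at h4
    rw [dist_comm q p] at h5
    linarith
  · have h3 := γ₂.dist_add_dist hq
    rw [h2, h2'] at h3
    have h4 := dist_triangle w q p
    have h5 := dist_triangle p q γ.terminal
    rw [dist_comm q p] at h4
    unfold gromovProd at *
    rw [dist_comm w γ.initial] at ha hb
    linarith

theorem IsDeltaHyperbolic.fourPoint (hhyp : IsDeltaHyperbolic X δ) (hδ : 0 < δ)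
    (hgeo : IsGeodesicSpace X) : FourPoint X (6 * δ) := by
  intro w x y z
  obtain ⟨γ, rfl, rfl⟩ := hgeo x y
  obtain ⟨γ₁, h1, rfl⟩ := hgeo γ.initial z
  obtain ⟨γ₂, h2, h2'⟩ := hgeo γ₁.terminal γ.terminal
  obtain ⟨p, hp, hd⟩ := exists_dist_le_gromovProd hhyp hδ hgeo γ w
  rcases hhyp.exists_near hδ h1 h2.symm h2' hp with ⟨q, hq, hq'⟩ | ⟨q, hq, hq'⟩
  · left
    have h3 := gromovProd_le_dist γ₁ w hq
    rw [h1] at h3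
    linarith [dist_triangle w p q]
  · right
    have h3 := gromovProd_le_dist γ₂ w hq
    rw [h2, h2'] at h3
    linarith [dist_triangle w p q]

theorem abs_dist_proj_sub_gromovProd_le (hhyp : IsDeltaHyperbolic X δ) (hδ : 0 < δ)
    (hgeo : IsGeodesicSpace X) (γ : GeodesicSegment X) (z : X) {z' : X} (hz : z' ∈ proj γ z) :
    |dist γ.initial z' - gromovProd γ.initial z γ.terminal| ≤ 4 * δ := by
  obtain ⟨hz1, hz2⟩ := hz
  obtain ⟨p, hp, hd⟩ := exists_dist_le_gromovProd hhyp hδ hgeo γ z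
  have h1 : dist z z' ≤ dist z p := hz2 ▸ Metric.infDist_le_dist_of_mem hp
  have h2 := γ.dist_add_dist hz1
  have h3 := dist_triangle γ.initial z' z
  have h4 := dist_triangle z z' γ.terminal
  rw [dist_comm z' z] at h3
  unfold gromovProd at *
  rw [dist_comm z γ.initial] at *
  rw [abs_le]
  constructor <;> linarith

theorem dist_proj_terminal_le (hhyp : IsDeltaHyperbolic X δ) (hδ : 0 < δ)
    (hgeo : IsGeodesicSpace X) (γ : GeodesicSegment X) (z : X) {z' : X} (hz : z' ∈ proj γ z) :
    dist z' γ.terminal ≤ gromovProd γ.terminal γ.initial z + 4 * δ := by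
  have h1 := (abs_le.1 (abs_dist_proj_sub_gromovProd_le hhyp hδ hgeo γ z hz)).1
  have h2 := γ.dist_add_dist hz.1
  unfold gromovProd at *
  rw [dist_comm z γ.initial] at h1
  rw [dist_comm γ.terminal z]
  linarith

end Hyperbolic

/-! ### Pairs of segments fellow-travelling a common geodesic -/

/-- If `x, p, q, y` form a rough geodesic with a long middle part, then `p` and `q` are close to any
geodesic from `x` to `y`. -/
theorem FourPoint.gromovProd_le_of_crossed {θ : ℝ} (h4 : FourPoint X θ) {x y p q : X} {e : ℝ}
    (h1 : gromovProd p x q ≤ e) (h2 : gromovProd q p y ≤ e) (hD : 2 * e + θ < dist p q) :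
    gromovProd p x y ≤ e + θ ∧ gromovProd q x y ≤ e + θ := by
  have h5 := gromovProd_add p y q
  have h6 := gromovProd_add p x q
  rw [gromovProd_comm q p x, gromovProd_comm p q x] at h6
  constructor
  · rcases h4 p x q y with h | h
    · linarith
    · rw [gromovProd_comm] at h; linarith
  · rcases h4 q p y x with h | h
    · rw [gromovProd_comm] at h; linarith
    · linarith

theorem FourPoint.dist_le_of_near {θ : ℝ} (h4 : FourPoint X θ) {x y s t : X} {μ : ℝ}
    (hs : gromovProd s x y ≤ μ) (ht : gromovProd t x y ≤ μ) :
    dist s t ≤ |dist x s - dist x t| + 2 * μ + 2 * θ := by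
  have h1 := gromovProd_add x y s
  have h2 := gromovProd_add x y t
  have h3 : dist s t = dist x s + dist x t - 2 * gromovProd x s t := by
    unfold gromovProd
    rw [dist_comm s x]
    ring
  rcases h4 x s t y with h | h
  · have := neg_abs_le (dist x s - dist x t)
    linarith
  · rw [gromovProd_comm] at h
    have := le_abs_self (dist x s - dist x t)
    linarith

theorem FourPoint.ordered {θ : ℝ} (h4 : FourPoint X θ) {x y p q p' q' : X} {e F D : ℝ}
    (hθ : 0 < θ) (he : 0 ≤ e) (hF : 0 ≤ F) (hD : 100 * (e + θ + F) ≤ D)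
    (hpq : dist p q = D) (hpq' : dist p' q' = D)
    (h1 : gromovProd p x q ≤ e) (h2 : gromovProd q p y ≤ e)
    (h1' : gromovProd p' x q' ≤ e) (h2' : gromovProd q' p' y ≤ e)
    (hF1 : gromovProd p q' q ≤ gromovProd p p' q + F)
    (hF2 : gromovProd p' q q' ≤ gromovProd p' p q' + F)
    (hκ : dist x p ≤ dist x p') :
    dist x p + 3 / 4 * D ≤ dist x p' ∧ gromovProd q p q' ≤ e + θ ∧ gromovProd p' p q' ≤ e + θ ∧
      gromovProd q p p' ≤ e + θ + F ∧ gromovProd p' q q' ≤ e + θ + F := by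
  obtain ⟨hp, hq⟩ := h4.gromovProd_le_of_crossed h1 h2 (by linarith)
  obtain ⟨hp', hq'⟩ := h4.gromovProd_le_of_crossed h1' h2' (by linarith)
  have hlen : dist x p + D - 2 * e ≤ dist x q := by
    unfold gromovProd at h1; linarith
  have hlen' : dist x p' + D - 2 * e ≤ dist x q' := by
    unfold gromovProd at h1'; linarith
  have hup : dist x q ≤ dist x p + D := hpq ▸ dist_triangle _ _ _
  have hpp := h4.dist_le_of_near hp hp'
  have hqq := h4.dist_le_of_near hq hq'
  rw [abs_of_nonpos (by linarith)] at hpp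
  have hfar : dist x p + 3 / 4 * D ≤ dist x p' := by
    by_contra hcon
    rw [not_le] at hcon
    have h5 : gromovProd p p' q ≤ dist x p' - dist x p + 2 * e + 2 * θ + e := by
      unfold gromovProd
      have := dist_triangle x p' q
      rw [dist_comm p' p]
      linarith
    have h6 : D - 4 * e - 2 * θ ≤ gromovProd p q' q := by
      unfold gromovProd
      have := dist_triangle x p q'
      rw [dist_comm q' p, dist_comm q' q]
      rcases abs_cases (dist x q - dist x q') with ⟨h, _⟩ | ⟨h, _⟩ <;> rw [h] at hqq <;> linarith
    linarith
  have hA : gromovProd q p q' ≤ e + θ := by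
    rcases h4 q p y q' with h | h
    · linarith
    · exfalso
      unfold gromovProd at h h2 hq'
      have h5 := dist_triangle x q q'
      have h6 := dist_triangle x q y
      rw [dist_comm q' q] at h
      rw [dist_comm x q'] at *
      linarith
  have hB : gromovProd p' p q' ≤ e + θ := by
    rcases h4 p' x q' p with h | h
    · exfalso
      unfold gromovProd at h h1'
      have h5 := dist_triangle x p p'
      rw [dist_comm p' p] at h
      linarith
    · linarith
  refine ⟨hfar, hA, hB, ?_, by linarith⟩
  have h5 := gromovProd_add p p' q
  have h6 := gromovProd_add p q' q
  rw [gromovProd_comm p q p'] at h5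
  rw [gromovProd_comm p q q'] at h6
  linarith

theorem FourPoint.gromovProd_le_of_mem_seg {θ : ℝ} (h4 : FourPoint X θ) (η : GeodesicSegment X)
    {p q w : X} {A : ℝ} (h1 : gromovProd q p η.initial ≤ A) (h2 : gromovProd q p η.terminal ≤ A)
    (hA : 0 ≤ A) (hθ : 0 ≤ θ) (hw : w ∈ η.seg) : gromovProd q p w ≤ 2 * (A + θ) := by
  by_contra hcon
  rw [not_le] at hcon
  have h5 := ((h4 q p η.initial w).resolve_left (by linarith)).trans (add_le_add_left h1 θ)
  have h6 := ((h4 q p η.terminal w).resolve_left (by linarith)).trans (add_le_add_left h2 θ)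
  have h7 := η.dist_add_dist hw
  have h8 := dist_triangle η.initial q η.terminal
  have h9 : gromovProd q p w ≤ dist q w := by
    have := dist_triangle p w q
    unfold gromovProd
    rw [dist_comm w q] at this
    linarith
  unfold gromovProd at h5 h6
  rw [dist_comm η.initial q] at h8
  rw [dist_comm η.initial w] at h7
  rw [dist_comm w q] at h5 h6
  linarith

theorem diam_union_singleton_le_of_dist_terminal_le (γ : GeodesicSegment X) {A : Set X} {r : ℝ}
    (hr : 0 ≤ r) (hA : ∀ a ∈ A, a ∈ γ.seg ∧ dist a γ.terminal ≤ r) :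
    Metric.diam (A ∪ {γ.terminal}) ≤ r := by
  have hA' : ∀ a ∈ A ∪ {γ.terminal}, a ∈ γ.seg ∧ dist a γ.terminal ≤ r := by
    rintro a (ha | rfl)
    · exact hA a ha
    · exact ⟨γ.terminal_mem_seg, by simpa using hr⟩
  refine Metric.diam_le_of_forall_dist_le hr fun a ha b hb => ?_
  obtain ⟨⟨s, hs, rfl⟩, hs'⟩ := hA' a ha
  obtain ⟨⟨t, ht, rfl⟩, ht'⟩ := hA' b hb
  rw [γ.dist_toFun_terminal hs] at hs'
  rw [γ.dist_toFun_terminal ht] at ht'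
  rw [γ.isom s hs t ht, abs_le]
  constructor <;> linarith [hs.2, ht.2]

theorem diam_union_singleton_le_of_dist_initial_le (γ : GeodesicSegment X) {A : Set X} {r : ℝ}
    (hr : 0 ≤ r) (hA : ∀ a ∈ A, a ∈ γ.seg ∧ dist γ.initial a ≤ r) :
    Metric.diam (A ∪ {γ.initial}) ≤ r := by
  have hA' : ∀ a ∈ A ∪ {γ.initial}, a ∈ γ.seg ∧ dist γ.initial a ≤ r := by
    rintro a (ha | rfl)
    · exact hA a ha
    · exact ⟨γ.initial_mem_seg, by simpa using hr⟩
  refine Metric.diam_le_of_forall_dist_le hr fun a ha b hb => ?_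
  obtain ⟨⟨s, hs, rfl⟩, hs'⟩ := hA' a ha
  obtain ⟨⟨t, ht, rfl⟩, ht'⟩ := hA' b hb
  rw [γ.dist_initial_toFun hs] at hs'
  rw [γ.dist_initial_toFun ht] at ht'
  rw [γ.isom s hs t ht, abs_le]
  constructor <;> linarith [hs.1, ht.1]

theorem projSet_point_union (p : X) (A : Set X) {q : X} (hq : q = p) :
    Metric.diam (projSet (GeodesicSegment.point p) A ∪ {q}) = 0 := by
  refine Metric.diam_subsingleton ?_
  have : ∀ z ∈ projSet (GeodesicSegment.point p) A ∪ {q}, z = p := by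
    rintro z (hz | rfl)
    · obtain ⟨a, -, ⟨t, -, rfl⟩, -⟩ := Set.mem_iUnion₂.1 hz
      rfl
    · exact hq
  intro a ha b hb
  rw [this a ha, this b hb]

section

variable {δ : ℝ}

theorem diam_projSet_terminal_le (hhyp : IsDeltaHyperbolic X δ) (hδ : 0 < δ)
    (hgeo : IsGeodesicSpace X) (γ η : GeodesicSegment X) {A : ℝ} (hA : 0 ≤ A)
    (h1 : gromovProd γ.terminal γ.initial η.initial ≤ A)
    (h2 : gromovProd γ.terminal γ.initial η.terminal ≤ A) :
    Metric.diam (projSet γ η.seg ∪ {γ.terminal}) ≤ 2 * A + 16 * δ := by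
  refine diam_union_singleton_le_of_dist_terminal_le γ (by linarith) fun a ha => ?_
  obtain ⟨w, hw, ha⟩ := Set.mem_iUnion₂.1 ha
  have h3 := dist_proj_terminal_le hhyp hδ hgeo γ w ha
  have h4 := (hhyp.fourPoint hδ hgeo).gromovProd_le_of_mem_seg η h1 h2 hA (by linarith) hw
  exact ⟨ha.1, by linarith⟩

theorem diam_projSet_initial_le (hhyp : IsDeltaHyperbolic X δ) (hδ : 0 < δ)
    (hgeo : IsGeodesicSpace X) (γ η : GeodesicSegment X) {A : ℝ} (hA : 0 ≤ A)
    (h1 : gromovProd γ.initial γ.terminal η.initial ≤ A)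
    (h2 : gromovProd γ.initial γ.terminal η.terminal ≤ A) :
    Metric.diam (projSet γ η.seg ∪ {γ.initial}) ≤ 2 * A + 16 * δ := by
  refine diam_union_singleton_le_of_dist_initial_le γ (by linarith) fun a ha => ?_
  obtain ⟨w, hw, ha⟩ := Set.mem_iUnion₂.1 ha
  have h3 := (abs_le.1 (abs_dist_proj_sub_gromovProd_le hhyp hδ hgeo γ w ha)).2
  have h4 := (hhyp.fourPoint hδ hgeo).gromovProd_le_of_mem_seg η h1 h2 hA (by linarith) hw
  rw [gromovProd_comm] at h4
  exact ⟨ha.1, by linarith⟩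

end

/-! ### The action on the orbit of the basepoint -/

/-- A finitely generated group acting by isometries on a hyperbolic geodesic space, with a group
element and a constant as in `E0Spec`. -/
structure HypAction (S : Finset G) (ρ : G → X → X) (x0 : X) (φ : G) (δ E0 : ℝ) : Prop where
  gen : Subgroup.closure (S : Set G) = ⊤
  pos : 0 < δ
  geo : IsGeodesicSpace X
  hyp : IsDeltaHyperbolic X δ
  isom : ∀ g, Isometry (ρ g)
  mul : ∀ g h x, ρ (g * h) x = ρ g (ρ h x)
  one : ∀ x, ρ 1 x = x
  spec : E0Spec S ρ x0 φ E0

/-- The distance between two points of the orbit of `x0`. -/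
noncomputable def orbDist (ρ : G → X → X) (x0 : X) (g h : G) : ℝ := dist (ρ g x0) (ρ h x0)

theorem orbDist_nonneg {X G : Type*} [MetricSpace X] [Group G] (ρ : G → X → X) (x0 : X)
    (g h : G) : 0 ≤ orbDist ρ x0 g h := dist_nonneg

/-- The Gromov product of two points of the orbit of `x0`, based at a third one. -/
noncomputable def orbProd (ρ : G → X → X) (x0 : X) (w g h : G) : ℝ :=
  gromovProd (ρ w x0) (ρ g x0) (ρ h x0)

/-- Travelling from `x` to `y` one passes along the segment from `h` to `h * ψ`. -/
def Crossed (ρ : G → X → X) (x0 : X) (ψ : G) (e : ℝ) (x y h : G) : Prop :=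
  orbProd ρ x0 h x (h * ψ) ≤ e ∧ orbProd ρ x0 (h * ψ) h y ≤ e

namespace HypAction

variable {S : Finset G} {ρ : G → X → X} {x0 : X} {φ : G} {δ E0 : ℝ}

theorem E0_pos (H : HypAction S ρ x0 φ δ E0) : 0 < E0 := H.spec.1

theorem fourPoint (H : HypAction S ρ x0 φ δ E0) : FourPoint X (6 * δ) :=
  H.hyp.fourPoint H.pos H.geo

theorem orbDist_mul_left (H : HypAction S ρ x0 φ δ E0) (k g h : G) :
    orbDist ρ x0 (k * g) (k * h) = orbDist ρ x0 g h := by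
  rw [orbDist, H.mul, H.mul, (H.isom k).dist_eq, orbDist]

theorem orbProd_mul_left (H : HypAction S ρ x0 φ δ E0) (k w g h : G) :
    orbProd ρ x0 (k * w) (k * g) (k * h) = orbProd ρ x0 w g h := by
  rw [orbProd, H.mul, H.mul, H.mul, gromovProd_map (H.isom k), orbProd]

theorem crossed_mul_left (H : HypAction S ρ x0 φ δ E0) (k : G) {ψ x y h : G} {e : ℝ} :
    Crossed ρ x0 ψ e (k * x) (k * y) (k * h) ↔ Crossed ρ x0 ψ e x y h := by
  rw [Crossed, mul_assoc k h, H.orbProd_mul_left, H.orbProd_mul_left, Crossed]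

theorem exists_lipschitz (H : HypAction S ρ x0 φ δ E0) :
    ∃ K : ℕ, 1 ≤ K ∧ ∀ g h : G, orbDist ρ x0 g h ≤ K * wordLength S (g⁻¹ * h) := by
  obtain ⟨K, hK⟩ : ∃ K : ℕ, ∀ s ∈ S, orbDist ρ x0 1 s ≤ K := by
    obtain ⟨K, hK⟩ := exists_nat_ge (∑ s ∈ S, orbDist ρ x0 1 s)
    exact ⟨K, fun s hs => (Finset.single_le_sum (f := fun s => orbDist ρ x0 1 s)
      (fun _ _ => dist_nonneg) hs).trans hK⟩
  have hK' : ∀ s : G, s ∈ S ∨ s⁻¹ ∈ S → orbDist ρ x0 1 s ≤ ((K + 1 : ℕ) : ℝ) := by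
    rintro s (hs | hs)
    · push_cast; linarith [hK s hs]
    · rw [← H.orbDist_mul_left s⁻¹, inv_mul_cancel, mul_one, orbDist, dist_comm]
      have := hK _ hs
      rw [orbDist] at this
      push_cast; linarith
  have key : ∀ l : List G, (∀ x ∈ l, x ∈ S ∨ x⁻¹ ∈ S) →
      orbDist ρ x0 1 l.prod ≤ ((K + 1 : ℕ) : ℝ) * l.length := by
    intro l
    induction l with
    | nil => intro _; simp [orbDist]
    | cons s l ih =>
      intro hl
      rw [List.prod_cons, List.length_cons]
      have h1 := hK' s (hl s (by simp))
      have h2 := ih fun x hx => hl x (by simp [hx])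
      rw [← H.orbDist_mul_left s, mul_one] at h2
      have h3 : orbDist ρ x0 1 (s * l.prod) ≤ orbDist ρ x0 1 s + orbDist ρ x0 s (s * l.prod) :=
        dist_triangle _ _ _
      rw [Nat.cast_succ (n := l.length)]
      linarith
  refine ⟨K + 1, by omega, fun g h => ?_⟩
  obtain ⟨l, hl, hl', hp⟩ := exists_minimal_word H.gen (g⁻¹ * h)
  have := key l hl'
  rwa [hp, hl, ← H.orbDist_mul_left g, mul_one, mul_inv_cancel_left] at this

theorem orbProd_le_of_far (H : HypAction S ρ x0 φ δ E0) {L : ℕ} (hL : 0 < L) {h h' : G}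
    (hfar : E0 + 2 * (L : ℝ) * (wordLength S φ : ℝ) < wordLength S (h⁻¹ * h')) :
    orbProd ρ x0 h (h' * φ ^ L) (h * φ ^ L) ≤ orbProd ρ x0 h h' (h * φ ^ L) + (E0 + 8 * δ) := by
  set g := h⁻¹ * h' with hg
  have hh' : h' = h * g := by rw [hg]; group
  have e1 : orbProd ρ x0 h (h' * φ ^ L) (h * φ ^ L) = orbProd ρ x0 1 (g * φ ^ L) (φ ^ L) := by
    rw [hh', mul_assoc, ← H.orbProd_mul_left h 1, mul_one]
  have e2 : orbProd ρ x0 h h' (h * φ ^ L) = orbProd ρ x0 1 g (φ ^ L) := by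
    rw [hh', ← H.orbProd_mul_left h 1, mul_one]
  rw [e1, e2]
  by_contra hcon
  rw [not_le] at hcon
  obtain ⟨γ, hγ, hγ'⟩ := H.geo x0 (ρ (φ ^ L) x0)
  obtain ⟨p, hp⟩ := proj_nonempty γ (ρ g x0)
  obtain ⟨q, hq⟩ := proj_nonempty γ (ρ (g * φ ^ L) x0)
  have hp' := (abs_le.1 (abs_dist_proj_sub_gromovProd_le H.hyp H.pos H.geo γ _ hp)).2
  have hq' := (abs_le.1 (abs_dist_proj_sub_gromovProd_le H.hyp H.pos H.geo γ _ hq)).1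
  rw [hγ'] at hp' hq'
  rw [orbProd, orbProd, H.one, ← hγ] at hcon
  have h0 := H.E0_pos
  have h1 := H.pos
  rw [hγ] at hp' hq' hcon
  obtain ⟨i, j, hi, hj, hij⟩ := H.spec.2.2 L hL g γ hγ hγ' p hp q hq
    (γ.before_of_dist_le hp.1 hq.1 (by rw [hγ]; linarith))
    (by have := dist_triangle x0 p q; linarith)
  rw [wordDist] at hij
  have h2 : wordLength S g ≤ wordLength S (φ ^ i) + wordLength S ((φ ^ i)⁻¹ * (g * φ ^ j)) +
      wordLength S (φ ^ j) := by
    have e : g = φ ^ i * ((φ ^ i)⁻¹ * (g * φ ^ j)) * (φ ^ j)⁻¹ := by group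
    conv_lhs => rw [e]
    refine (wordLength_mul_le H.gen _ _).trans ?_
    rw [wordLength_inv H.gen]
    exact Nat.add_le_add_right (wordLength_mul_le H.gen _ _) _
  have h3 : wordLength S (φ ^ i) ≤ L * wordLength S φ :=
    (wordLength_pow_le H.gen φ i).trans (Nat.mul_le_mul_right _ hi)
  have h4 : wordLength S (φ ^ j) ≤ L * wordLength S φ :=
    (wordLength_pow_le H.gen φ j).trans (Nat.mul_le_mul_right _ hj)
  have h5 : (wordLength S g : ℝ) ≤ L * wordLength S φ + wordLength S ((φ ^ i)⁻¹ * (g * φ ^ j)) +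
      L * wordLength S φ := by
    exact_mod_cast h2.trans (by omega)
  linarith

/-- Far apart segments crossed by the same geodesic are linearly ordered along it. -/
theorem ordered (H : HypAction S ρ x0 φ δ E0) {L : ℕ} (hL : 0 < L) {e : ℝ} (he : 0 ≤ e)
    (hD : 100 * (e + E0 + 14 * δ) ≤ orbDist ρ x0 1 (φ ^ L)) {x y h h' : G}
    (hc : Crossed ρ x0 (φ ^ L) e x y h) (hc' : Crossed ρ x0 (φ ^ L) e x y h')
    (hfar : E0 + 2 * (L : ℝ) * (wordLength S φ : ℝ) < wordLength S (h⁻¹ * h'))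
    (hle : orbDist ρ x0 x h ≤ orbDist ρ x0 x h') :
    orbDist ρ x0 x h + 3 / 4 * orbDist ρ x0 1 (φ ^ L) ≤ orbDist ρ x0 x h' ∧
      orbProd ρ x0 (h * φ ^ L) h (h' * φ ^ L) ≤ e + 6 * δ ∧
      orbProd ρ x0 h' h (h' * φ ^ L) ≤ e + 6 * δ ∧
      orbProd ρ x0 (h * φ ^ L) h h' ≤ e + E0 + 14 * δ ∧
      orbProd ρ x0 h' (h * φ ^ L) (h' * φ ^ L) ≤ e + E0 + 14 * δ := by
  have h0 := H.E0_pos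
  have h1 := H.pos
  have hfar' : E0 + 2 * (L : ℝ) * (wordLength S φ : ℝ) < wordLength S (h'⁻¹ * h) := by
    rwa [← wordLength_inv H.gen (h'⁻¹ * h), mul_inv_rev, inv_inv]
  have hpq : ∀ h : G, dist (ρ h x0) (ρ (h * φ ^ L) x0) = orbDist ρ x0 1 (φ ^ L) := by
    intro h
    rw [← H.orbDist_mul_left h, mul_one, orbDist]
  obtain ⟨a, b, c, d, f⟩ := H.fourPoint.ordered (by linarith) he
    (by linarith : 0 ≤ E0 + 8 * δ) (by linarith) (hpq h) (hpq h') hc.1 hc.2 hc'.1 hc'.2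
    (H.orbProd_le_of_far hL hfar) (H.orbProd_le_of_far hL hfar') hle
  exact ⟨a, b, c, d.trans (by linarith), f.trans (by linarith)⟩

theorem orbDist_le_of_crossed (H : HypAction S ρ x0 φ δ E0) {L : ℕ} {e : ℝ}
    (hD : 100 * (e + E0 + 14 * δ) ≤ orbDist ρ x0 1 (φ ^ L)) {x y h : G}
    (hc : Crossed ρ x0 (φ ^ L) e x y h) (he : 0 ≤ e) :
    orbDist ρ x0 x h ≤ orbDist ρ x0 x y + 2 * (e + 6 * δ) := by
  have h0 := H.E0_pos
  have h1 := H.pos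
  have hpq : dist (ρ h x0) (ρ (h * φ ^ L) x0) = orbDist ρ x0 1 (φ ^ L) := by
    rw [← H.orbDist_mul_left h, mul_one, orbDist]
  have h2 := (H.fourPoint.gromovProd_le_of_crossed hc.1 hc.2 (by rw [hpq]; linarith)).1
  unfold gromovProd at h2
  unfold orbDist
  linarith [dist_nonneg (x := ρ h x0) (y := ρ y x0)]

/-- The number of segments crossed by a geodesic grows at most linearly with its length. -/
theorem exists_crossed_bound (H : HypAction S ρ x0 φ δ E0) {L : ℕ} (hL : 0 < L) {e : ℝ}
    (he : 0 ≤ e) (hD : 100 * (e + E0 + 14 * δ) ≤ orbDist ρ x0 1 (φ ^ L))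
    (hD1 : 4 ≤ orbDist ρ x0 1 (φ ^ L)) :
    ∃ C : ℕ, 1 ≤ C ∧ ∀ n : ℕ, ∀ x y : G, wordLength S (x⁻¹ * y) ≤ n →
      {h | Crossed ρ x0 (φ ^ L) e x y h}.Finite ∧
        {h | Crossed ρ x0 (φ ^ L) e x y h}.ncard ≤ C * (n + 1) := by
  obtain ⟨K, hK1, hK⟩ := H.exists_lipschitz
  have h0 := H.E0_pos
  have h1 := H.pos
  obtain ⟨c, hc⟩ := exists_nat_ge (2 * (e + 6 * δ))
  set R := E0 + 2 * (L : ℝ) * (wordLength S φ : ℝ) with hR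
  have hR0 : 0 ≤ R := by positivity
  refine ⟨(K + c + 1) * (ball S R).ncard, ?_, fun n x y hxy => ?_⟩
  · exact Nat.mul_pos (by omega) (one_le_ncard_ball H.gen hR0)
  have hsep := finite_and_ncard_le_of_separated H.gen R hR0 {h | Crossed ρ x0 (φ ^ L) e x y h}
    ((K + c + 1) * (n + 1)) ?_
  · refine ⟨hsep.1, hsep.2.trans_eq (by ring)⟩
  intro T hT hTs
  have hmaps : ∀ h ∈ T, ⌊orbDist ρ x0 x h⌋₊ ∈ Finset.range ((K + c + 1) * (n + 1)) := by
    intro h hh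
    rw [Finset.mem_range, Nat.floor_lt (orbDist_nonneg ..)]
    have h2 := H.orbDist_le_of_crossed hD (hT hh) he
    have h3 := hK x y
    have h4 : (K : ℝ) * wordLength S (x⁻¹ * y) ≤ K * n := by gcongr
    push_cast
    have : (0 : ℝ) ≤ c * n := by positivity
    nlinarith
  rw [← Finset.card_range ((K + c + 1) * (n + 1))]
  refine Finset.card_le_card_of_injOn (fun h => ⌊orbDist ρ x0 x h⌋₊) hmaps ?_
  have key : ∀ a ∈ T, ∀ b ∈ T, a ≠ b → orbDist ρ x0 x a ≤ orbDist ρ x0 x b →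
      ⌊orbDist ρ x0 x a⌋₊ ≠ ⌊orbDist ρ x0 x b⌋₊ := by
    intro a ha b hb hab hle
    have h2 := (H.ordered hL he hD (hT ha) (hT hb) (hTs a ha b hb hab) hle).1
    have h3 : ⌊orbDist ρ x0 x a⌋₊ + 1 ≤ ⌊orbDist ρ x0 x b⌋₊ := by
      rw [← Nat.floor_add_one (orbDist_nonneg ..)]
      exact Nat.floor_le_floor (by linarith)
    omega
  intro a ha b hb hab
  by_contra hne
  rcases le_total (orbDist ρ x0 x a) (orbDist ρ x0 x b) with hle | hle
  · exact key a ha b hb hne hle hab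
  · exact key b hb a ha (Ne.symm hne) hle hab.symm

end HypAction

theorem exists_sorted_enumeration (T : Finset G) (κ : G → ℝ) :
    ∃ f : ℕ → G, (∀ i < T.card, f i ∈ T) ∧
      ∀ i j, i < j → j < T.card → f i ≠ f j ∧ κ (f i) ≤ κ (f j) := by
  classical
  let g : Fin T.card → G := fun i => (T.equivFin.symm i : G)
  have hg : Function.Injective g := fun i j h => T.equivFin.symm.injective (Subtype.ext h)
  let σ := Tuple.sort (κ ∘ g)
  have hσ : Monotone ((κ ∘ g) ∘ σ) := Tuple.monotone_sort _
  refine ⟨fun i => if h : i < T.card then g (σ ⟨i, h⟩) else 1, fun i hi => ?_,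
    fun i j hij hj => ?_⟩
  · simp only [hi, dite_true]
    exact (T.equivFin.symm _).2
  · have hi : i < T.card := hij.trans hj
    simp only [hi, hj, dite_true]
    refine ⟨fun h => ?_, hσ (show (⟨i, hi⟩ : Fin T.card) ≤ ⟨j, hj⟩ from hij.le)⟩
    have := σ.injective (hg h)
    simp only [Fin.mk.injEq] at this
    omega

/-! ### Loxodromic elements and non-elementarity -/

namespace HypAction

variable {S : Finset G} {ρ : G → X → X} {x0 : X} {φ : G} {δ E0 : ℝ}

theorem orbDist_one_inv (H : HypAction S ρ x0 φ δ E0) (g : G) :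
    orbDist ρ x0 1 g⁻¹ = orbDist ρ x0 1 g := by
  rw [← H.orbDist_mul_left g, mul_one, mul_inv_cancel, orbDist, dist_comm, orbDist]

theorem orbDist_one_zpow (H : HypAction S ρ x0 φ δ E0) (m : ℤ) :
    orbDist ρ x0 1 (φ ^ m) = orbDist ρ x0 1 (φ ^ m.natAbs) := by
  rcases Int.natAbs_eq m with h | h
  · conv_lhs => rw [h, zpow_natCast]
  · conv_lhs => rw [h, zpow_neg, zpow_natCast, H.orbDist_one_inv]

theorem orbDist_one_mul_le (H : HypAction S ρ x0 φ δ E0) (g h : G) :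
    orbDist ρ x0 1 (g * h) ≤ orbDist ρ x0 1 g + orbDist ρ x0 1 h := by
  rw [← H.orbDist_mul_left g 1 h, mul_one]
  exact dist_triangle _ _ _

theorem exists_translationLength (H : HypAction S ρ x0 φ δ E0) (hlox : IsLoxodromic ρ x0 φ) :
    ∃ τ : ℝ, 0 < τ ∧ ∀ m : ℕ, Filter.Tendsto
      (fun k : ℕ => orbDist ρ x0 1 (φ ^ (m * k)) / k) Filter.atTop (nhds (m * τ)) := by
  obtain ⟨τ, hτ, hlim⟩ := hlox
  refine ⟨τ, hτ, fun m => ?_⟩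
  rcases Nat.eq_zero_or_pos m with rfl | hm
  · simp [orbDist]
  have h1 : Filter.Tendsto (fun k : ℕ => m * k) Filter.atTop Filter.atTop :=
    Filter.tendsto_id.const_mul_atTop' hm
  refine ((hlim.comp h1).const_mul (m : ℝ)).congr fun k => ?_
  have hm' : (m : ℝ) ≠ 0 := by positivity
  simp only [Function.comp_apply, orbDist, H.one, Nat.cast_mul]
  rcases Nat.eq_zero_or_pos k with rfl | hk
  · simp
  have hk' : (k : ℝ) ≠ 0 := by positivity
  field_simp

theorem tendsto_orbDist_pow (H : HypAction S ρ x0 φ δ E0) (hlox : IsLoxodromic ρ x0 φ) :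
    Filter.Tendsto (fun n : ℕ => orbDist ρ x0 1 (φ ^ n)) Filter.atTop Filter.atTop := by
  obtain ⟨τ, hτ, hlim⟩ := H.exists_translationLength hlox
  have h1 := hlim 1
  simp only [one_mul, Nat.cast_one] at h1
  refine (h1.pos_mul_atTop hτ tendsto_natCast_atTop_atTop).congr' ?_
  filter_upwards [Filter.eventually_gt_atTop 0] with k hk
  have hk' : (k : ℝ) ≠ 0 := by positivity
  field_simp

theorem natAbs_eq_of_conj (H : HypAction S ρ x0 φ δ E0) (hlox : IsLoxodromic ρ x0 φ) {s : G}
    {a b : ℤ} (hab : s * φ ^ a * s⁻¹ = φ ^ b) : a.natAbs = b.natAbs := by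
  obtain ⟨τ, hτ, hlim⟩ := H.exists_translationLength hlox
  have hconj : ∀ k : ℕ, s * φ ^ (a * k) * s⁻¹ = φ ^ (b * k) := by
    intro k
    rw [zpow_mul, zpow_mul, ← hab, zpow_natCast, zpow_natCast, conj_pow]
  have hd : ∀ (m : ℤ) (k : ℕ), orbDist ρ x0 1 (φ ^ (m * k)) = orbDist ρ x0 1 (φ ^ (m.natAbs * k)) := by
    intro m k
    rw [H.orbDist_one_zpow, Int.natAbs_mul, Int.natAbs_natCast]
  have hbd : ∀ k : ℕ, |orbDist ρ x0 1 (φ ^ (a.natAbs * k)) - orbDist ρ x0 1 (φ ^ (b.natAbs * k))|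
      ≤ 2 * orbDist ρ x0 1 s := by
    intro k
    rw [← hd, ← hd]
    have h1 := H.orbDist_one_mul_le (s * φ ^ (a * k)) s⁻¹
    have h2 := H.orbDist_one_mul_le s (φ ^ (a * k))
    have h3 := H.orbDist_one_mul_le (s⁻¹ * φ ^ (b * k)) s
    have h4 := H.orbDist_one_mul_le s⁻¹ (φ ^ (b * k))
    rw [hconj] at h1
    have e : s⁻¹ * φ ^ (b * k) * s = φ ^ (a * k) := by rw [← hconj]; group
    rw [e] at h3
    rw [H.orbDist_one_inv] at h1 h4
    rw [abs_le]
    constructor <;> linarith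
  have hlim' := (hlim a.natAbs).sub (hlim b.natAbs)
  have h0 : Filter.Tendsto (fun k : ℕ => orbDist ρ x0 1 (φ ^ (a.natAbs * k)) / k -
      orbDist ρ x0 1 (φ ^ (b.natAbs * k)) / k) Filter.atTop (nhds 0) := by
    refine squeeze_zero_norm (a := fun k : ℕ => 2 * orbDist ρ x0 1 s / k) (fun k => ?_)
      (tendsto_const_div_atTop_nhds_zero_nat _)
    rw [← sub_div, Real.norm_eq_abs, abs_div, Nat.abs_cast]
    exact div_le_div_of_nonneg_right (hbd k) (Nat.cast_nonneg k)
  have h1 := tendsto_nhds_unique hlim' h0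
  have h2 : ((a.natAbs : ℝ) - b.natAbs) * τ = 0 := by linarith
  rcases mul_eq_zero.1 h2 with h | h
  · exact_mod_cast sub_eq_zero.1 h
  · exact absurd h hτ.ne'

/-- An element commuting with a power of `φ` is a bounded perturbation of a power of `φ`. -/
theorem exists_eq_of_commute (H : HypAction S ρ x0 φ δ E0) (hlox : IsLoxodromic ρ x0 φ) {h : G}
    {A : ℕ} (hA : 0 < A) (hc : h * φ ^ A = φ ^ A * h) :
    ∃ (i j : ℕ) (β : G), β ∈ ball S E0 ∧ h = φ ^ i * β * (φ ^ j)⁻¹ := by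
  have hlarge : ∀ᶠ k : ℕ in Filter.atTop,
      4 * orbDist ρ x0 1 h + E0 + 8 * δ + 1 ≤ orbDist ρ x0 1 (φ ^ (A * k)) :=
    ((H.tendsto_orbDist_pow hlox).comp
      (Filter.tendsto_id.const_mul_atTop' hA)).eventually_ge_atTop _
  obtain ⟨k, hk, hk0⟩ := (hlarge.and (Filter.eventually_gt_atTop 0)).exists
  have hc' : h * φ ^ (A * k) = φ ^ (A * k) * h := by
    rw [pow_mul]
    exact ((show Commute h (φ ^ A) from hc).pow_right k).eq
  set n := A * k with hn
  obtain ⟨γ, hγ, hγ'⟩ := H.geo x0 (ρ (φ ^ n) x0)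
  obtain ⟨p, hp⟩ := proj_nonempty γ (ρ h x0)
  obtain ⟨q, hq⟩ := proj_nonempty γ (ρ (h * φ ^ n) x0)
  have hpd : dist (ρ h x0) p ≤ orbDist ρ x0 1 h := by
    rw [hp.2]
    refine (Metric.infDist_le_dist_of_mem γ.initial_mem_seg).trans_eq ?_
    rw [hγ, dist_comm, orbDist, H.one]
  have hqd : dist (ρ (h * φ ^ n) x0) q ≤ orbDist ρ x0 1 h := by
    rw [hq.2]
    refine (Metric.infDist_le_dist_of_mem γ.terminal_mem_seg).trans_eq ?_
    rw [hγ', dist_comm, hc', H.mul, (H.isom _).dist_eq, orbDist, H.one]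
  have hd : orbDist ρ x0 1 (φ ^ n) = dist x0 (ρ (φ ^ n) x0) := by rw [orbDist, H.one]
  have hqd' : dist (ρ (φ ^ n) x0) (ρ (h * φ ^ n) x0) = orbDist ρ x0 1 h := by
    rw [hc', H.mul, (H.isom _).dist_eq, orbDist, H.one]
  have hpd' : dist x0 (ρ h x0) = orbDist ρ x0 1 h := by rw [orbDist, H.one]
  have t1 := dist_triangle x0 (ρ h x0) p
  have t2 := dist_triangle x0 q (ρ (φ ^ n) x0)
  have t3 := dist_triangle (ρ (φ ^ n) x0) (ρ (h * φ ^ n) x0) q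
  have t4 := dist_triangle x0 p q
  rw [dist_comm _ q] at t3
  have h1 := H.pos
  have h0 := H.E0_pos
  obtain ⟨i, j, -, -, hij⟩ := H.spec.2.2 n (Nat.mul_pos hA hk0) h γ hγ hγ' p hp q hq
    (γ.before_of_dist_le hp.1 hq.1 (by rw [hγ]; linarith)) (by linarith)
  exact ⟨i, j, (φ ^ i)⁻¹ * (h * φ ^ j), hij.le, by group⟩

/-- If a power of `φ` generates a normal subgroup then `G` is virtually cyclic. -/
theorem false_of_conj (H : HypAction S ρ x0 φ δ E0) (hlox : IsLoxodromic ρ x0 φ)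
    (hNVC : NonVirtuallyCyclic G) {A : ℕ} (hA : 0 < A)
    (hconj : ∀ s ∈ S, s * φ ^ A * s⁻¹ = φ ^ A ∨ s * φ ^ A * s⁻¹ = (φ ^ A)⁻¹) : False := by
  set z := φ ^ A with hz
  have hall : ∀ g : G, g * z * g⁻¹ = z ∨ g * z * g⁻¹ = z⁻¹ := by
    intro g
    have hg : g ∈ Subgroup.closure (S : Set G) := by rw [H.gen]; trivial
    induction hg using Subgroup.closure_induction with
    | mem s hs => exact hconj s hs
    | one => left; simp
    | mul x y _ _ hx hy =>
      have e : x * y * z * (x * y)⁻¹ = x * (y * z * y⁻¹) * x⁻¹ := by group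
      rw [e]
      rcases hy with hy | hy <;> rw [hy]
      · exact hx
      · rw [← conj_inv]
        rcases hx with hx | hx <;> rw [hx]
        · right; rfl
        · left; simp
    | inv x _ hx =>
      rcases hx with hx | hx
      · left
        conv_lhs => rw [← hx]
        group
      · right
        have : z = x⁻¹ * z⁻¹ * x := by rw [← hx]; group
        have h2 : z⁻¹ = x⁻¹ * z * x := by
          conv_lhs => rw [this]
          group
        rw [h2]; group
  have hnorm : (Subgroup.zpowers z).Normal := by
    refine ⟨fun n hn g => ?_⟩
    obtain ⟨k, rfl⟩ := Subgroup.mem_zpowers_iff.1 hn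
    rw [← conj_zpow]
    refine Subgroup.zpow_mem _ ?_ k
    rcases hall g with h | h <;> rw [h]
    · exact Subgroup.mem_zpowers z
    · exact inv_mem (Subgroup.mem_zpowers z)
  obtain ⟨k, hk⟩ : ∃ k : G, ∀ g : G, g * z = z * g ∨ (g * k) * z = z * (g * k) := by
    by_cases h : ∃ k : G, k * z * k⁻¹ = z⁻¹
    · obtain ⟨k, hk⟩ := h
      refine ⟨k, fun g => ?_⟩
      rcases hall g with hg | hg
      · left; rw [← mul_inv_eq_iff_eq_mul]; exact hg
      · right
        rw [← mul_inv_eq_iff_eq_mul]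
        have e : g * k * z * (g * k)⁻¹ = g * (k * z * k⁻¹) * g⁻¹ := by group
        rw [e, hk, ← conj_inv, hg, inv_inv]
    · refine ⟨1, fun g => Or.inl ?_⟩
      rw [← mul_inv_eq_iff_eq_mul]
      exact (hall g).resolve_right fun hg => h ⟨g, hg⟩
  let F : Set (G ⧸ Subgroup.zpowers z) := (fun x : (Fin A × Fin A) × G × G =>
    ((φ ^ (x.1.1 : ℕ) * x.2.1 * (φ ^ (x.1.2 : ℕ))⁻¹ * x.2.2 : G) : G ⧸ Subgroup.zpowers z)) ''
      (Set.univ ×ˢ (ball S E0 ×ˢ {1, k⁻¹}))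
  have hF : F.Finite := by
    refine Set.Finite.image _ (Set.finite_univ.prod ((finite_ball H.gen _).prod ?_))
    exact (Set.finite_singleton _).insert _
  have hz1 : ((z : G) : G ⧸ Subgroup.zpowers z) = 1 :=
    (QuotientGroup.eq_one_iff z).2 (Subgroup.mem_zpowers z)
  have hmod : ∀ i : ℕ, ((φ ^ i : G) : G ⧸ Subgroup.zpowers z) = ((φ ^ (i % A) : G) : _) := by
    intro i
    conv_lhs => rw [← Nat.mod_add_div i A, pow_add, pow_mul, ← hz]
    rw [QuotientGroup.mk_mul, QuotientGroup.mk_pow _ z, hz1, one_pow, mul_one]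
  have hcover : ∀ g l : G, l ∈ ({1, k⁻¹} : Set G) → g * z = z * g →
      ((g * l : G) : G ⧸ Subgroup.zpowers z) ∈ F := by
    intro g l hl hg
    obtain ⟨i, j, β, hβ, rfl⟩ := H.exists_eq_of_commute hlox hA hg
    refine ⟨((⟨i % A, Nat.mod_lt _ hA⟩, ⟨j % A, Nat.mod_lt _ hA⟩), β, l), ⟨trivial, hβ, hl⟩, ?_⟩
    simp only [QuotientGroup.mk_mul, QuotientGroup.mk_inv]
    rw [hmod i, hmod j]
  have huniv : (Set.univ : Set (G ⧸ Subgroup.zpowers z)) ⊆ F := by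
    intro x _
    obtain ⟨g, rfl⟩ := QuotientGroup.mk_surjective x
    rcases hk g with h | h
    · simpa using hcover g 1 (by simp) h
    · simpa using hcover (g * k) k⁻¹ (by simp) h
  have : Finite (G ⧸ Subgroup.zpowers z) := Set.finite_univ_iff.1 (hF.subset huniv)
  exact hNVC ⟨Subgroup.zpowers z, Subgroup.finiteIndex_of_finite_quotient, inferInstance⟩

/-- Some generator `s` is independent of `φ`. -/
theorem exists_independent (H : HypAction S ρ x0 φ δ E0) (hlox : IsLoxodromic ρ x0 φ)
    (hNVC : NonVirtuallyCyclic G) :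
    ∃ s ∈ S, Function.Injective fun x : ℕ × ℕ => φ ^ x.1 * s * φ ^ x.2 := by
  by_contra hcon
  push Not at hcon
  have hcol : ∀ s ∈ S, ∃ a : ℕ, 0 < a ∧ (s * φ ^ a * s⁻¹ = φ ^ a ∨ s * φ ^ a * s⁻¹ = (φ ^ a)⁻¹) := by
    intro s hs
    obtain ⟨⟨i, j⟩, ⟨k, l⟩, he, hne⟩ := Function.not_injective_iff.1 (hcon s hs)
    simp only at he
    have hab : s * φ ^ ((j : ℤ) - l) * s⁻¹ = φ ^ ((k : ℤ) - i) := by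
      rw [zpow_sub, zpow_sub, zpow_natCast, zpow_natCast, zpow_natCast, zpow_natCast]
      have h1 : s * φ ^ j = (φ ^ i)⁻¹ * (φ ^ k * s * φ ^ l) := by rw [← he]; group
      have h2 : s * (φ ^ j * (φ ^ l)⁻¹) * s⁻¹ = (s * φ ^ j) * (φ ^ l)⁻¹ * s⁻¹ := by group
      rw [h2, h1]
      rw [← zpow_natCast, ← zpow_natCast φ k, ← zpow_natCast φ l]
      group
    have hnat := H.natAbs_eq_of_conj hlox hab
    refine ⟨((j : ℤ) - l).natAbs, ?_, ?_⟩
    · rw [Int.natAbs_pos]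
      intro h0
      refine hne (Prod.ext ?_ ?_) <;> dsimp only <;> omega
    · have hsgn : (s * φ ^ ((j : ℤ) - l).natAbs * s⁻¹ = φ ^ ((k : ℤ) - i)) ∨
          (s * φ ^ ((j : ℤ) - l).natAbs * s⁻¹ = (φ ^ ((k : ℤ) - i))⁻¹) := by
        rcases Int.natAbs_eq ((j : ℤ) - l) with h | h
        · left; rw [← zpow_natCast, ← h, hab]
        · right
          have h' : ((((j : ℤ) - l).natAbs : ℕ) : ℤ) = -((j : ℤ) - l) := by omega
          rw [← zpow_natCast, h', zpow_neg, ← conj_inv, hab]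
      rcases Int.natAbs_eq ((k : ℤ) - i) with h | h
      · rw [h, zpow_natCast, ← hnat] at hsgn
        exact hsgn
      · rw [h, zpow_neg, zpow_natCast, ← hnat, inv_inv] at hsgn
        exact hsgn.symm
  choose! a ha hconj using hcol
  refine H.false_of_conj hlox hNVC (A := ∏ s ∈ S, a s) (Finset.prod_pos ha) fun s hs => ?_
  obtain ⟨c, hc⟩ := Finset.dvd_prod_of_mem a hs
  rw [hc, pow_mul, ← conj_pow]
  rcases hconj s hs with h | h <;> rw [h]
  · left; rfl
  · right; rw [inv_pow]

end HypAction

/-! ### Growth of balls -/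

theorem finite_and_ncard_fiber_le {β γ ι : Type*} {U : Set β} (hU : U.Finite) {F : β → Set γ}
    {N : ℕ} (hF : ∀ u ∈ U, (F u).Finite ∧ (F u).ncard ≤ N) {E : Set ι} (hE : E.Finite) :
    {x : β × γ × ι | x.1 ∈ U ∧ x.2.1 ∈ F x.1 ∧ x.2.2 ∈ E}.Finite ∧
      {x : β × γ × ι | x.1 ∈ U ∧ x.2.1 ∈ F x.1 ∧ x.2.2 ∈ E}.ncard ≤ U.ncard * (N * E.ncard) := by
  classical
  let f : β → Finset γ := fun u => if h : (F u).Finite then h.toFinset else ∅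
  have hf : ∀ u ∈ U, (f u : Set γ) = F u ∧ (f u).card ≤ N := by
    intro u hu
    have h := (hF u hu).1
    have e : f u = h.toFinset := dif_pos h
    refine ⟨by rw [e, h.coe_toFinset], ?_⟩
    rw [e, ← Set.ncard_eq_toFinset_card _ h]
    exact (hF u hu).2
  let T : Finset (β × γ × ι) :=
    hU.toFinset.biUnion fun u => (f u ×ˢ hE.toFinset).image fun x => (u, x)
  have hT : {x : β × γ × ι | x.1 ∈ U ∧ x.2.1 ∈ F x.1 ∧ x.2.2 ∈ E} ⊆ T := by
    rintro ⟨u, h, e⟩ ⟨h1, h2, h3⟩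
    dsimp only at h1 h2 h3
    rw [← (hf u h1).1] at h2
    simp only [T, Finset.coe_biUnion, Set.mem_iUnion, Finset.mem_coe, Finset.mem_image]
    exact ⟨u, by simpa using h1, (h, e), by simpa using ⟨h2, h3⟩, rfl⟩
  refine ⟨T.finite_toSet.subset hT, (Set.ncard_le_ncard hT T.finite_toSet).trans ?_⟩
  rw [Set.ncard_coe_finset, Set.ncard_eq_toFinset_card _ hU, Set.ncard_eq_toFinset_card _ hE]
  refine Finset.card_biUnion_le_card_mul _ _ _ fun u hu => Finset.card_image_le.trans ?_
  rw [Finset.card_product]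
  exact Nat.mul_le_mul_right _ (hf u (by simpa using hu)).2

/-- The generators together with the identity. -/
def genOne (S : Finset G) : Set G := {s | s ∈ S ∨ s = 1}

theorem finite_genOne (S : Finset G) : (genOne S).Finite :=
  (S.finite_toSet.union (Set.finite_singleton 1)).subset fun _ h => h

theorem one_le_ncard_genOne (S : Finset G) : 1 ≤ (genOne S).ncard :=
  (Set.ncard_pos (finite_genOne S)).2 ⟨1, Or.inr rfl⟩

namespace HypAction

variable {S : Finset G} {ρ : G → X → X} {x0 : X} {φ : G} {δ E0 : ℝ}

theorem exists_left (H : HypAction S ρ x0 φ δ E0) {L : ℕ} (hL : 0 < L) (a : G) :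
    ∃ s ∈ genOne S, orbProd ρ x0 (a * s⁻¹) 1 (a * s⁻¹ * φ ^ L) ≤ E0 := by
  obtain ⟨s, -, hs, -, h, -⟩ := H.spec.2.1 a⁻¹
  refine ⟨s, hs, ?_⟩
  have h1 := h L (by exact_mod_cast hL)
  rw [zpow_natCast, gromovProd_comm] at h1
  have e : s * a⁻¹ * (a * s⁻¹ * φ ^ L) = φ ^ L := by group
  rw [← H.orbProd_mul_left (s * a⁻¹), e]
  simpa [orbProd, H.one] using h1

theorem exists_right (H : HypAction S ρ x0 φ δ E0) {L : ℕ} (hL : 0 < L) (b : G) :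
    ∃ t ∈ genOne S, ∀ h : G, orbProd ρ x0 (h * φ ^ L) h (h * φ ^ L * (t * b)) ≤ E0 := by
  obtain ⟨-, t, -, ht, -, h⟩ := H.spec.2.1 b
  refine ⟨t, ht, fun g => ?_⟩
  have h1 := h (-L) (by simpa using hL)
  have e : (g * φ ^ L)⁻¹ * (g * φ ^ L * (t * b)) = t * b := by group
  rw [← H.orbProd_mul_left (g * φ ^ L)⁻¹, e]
  simpa [orbProd, H.one] using h1

theorem wordLength_insert_le (H : HypAction S ρ x0 φ δ E0) (L : ℕ) (a b : G) {s t : G}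
    (hs : s ∈ genOne S) (ht : t ∈ genOne S) :
    wordLength S (a * s⁻¹ * φ ^ L * (t * b)) ≤
      wordLength S a + (L * wordLength S φ + 2) + wordLength S b := by
  have h1 := wordLength_mul_le H.gen (a * s⁻¹ * φ ^ L) (t * b)
  have h2 := wordLength_mul_le H.gen (a * s⁻¹) (φ ^ L)
  have h3 := wordLength_mul_le H.gen a s⁻¹
  have h4 := wordLength_mul_le H.gen t b
  have h5 := wordLength_le_one hs
  have h6 := wordLength_le_one ht
  have h7 := wordLength_pow_le H.gen φ L
  rw [wordLength_inv H.gen] at h3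
  omega

/-- Balls are supermultiplicative up to a linear factor. -/
theorem exists_supermultiplicative (H : HypAction S ρ x0 φ δ E0) {L : ℕ} (hL : 0 < L)
    (hD : 100 * (E0 + E0 + 14 * δ) ≤ orbDist ρ x0 1 (φ ^ L))
    (hD1 : 4 ≤ orbDist ρ x0 1 (φ ^ L)) :
    ∃ C : ℕ, 1 ≤ C ∧ ∀ p q : ℕ, (ball S (p : ℝ)).ncard * (ball S (q : ℝ)).ncard ≤
      C * (p + q + 1) * (ball S ((p + q : ℕ) : ℝ)).ncard := by
  obtain ⟨C, hC1, hC⟩ := H.exists_crossed_bound hL H.E0_pos.le hD hD1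
  set c := L * wordLength S φ + 2 with hc
  choose s hs hs' using H.exists_left hL
  choose t ht ht' using H.exists_right hL
  refine ⟨(ball S (c : ℝ)).ncard * (C * (c + 1) * ((genOne S).ncard * (genOne S).ncard)), ?_,
    fun p q => ?_⟩
  · have := one_le_ncard_ball H.gen (Nat.cast_nonneg (α := ℝ) c)
    have := one_le_ncard_genOne S
    refine Nat.mul_pos (by omega) (Nat.mul_pos (Nat.mul_pos hC1 (by omega))
      (Nat.mul_pos (by omega) (by omega)))
  have hfib := finite_and_ncard_fiber_le (finite_ball H.gen ((p + q + c : ℕ) : ℝ))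
    (F := fun u => {h | Crossed ρ x0 (φ ^ L) E0 1 u h}) (N := C * (p + q + c + 1))
    (fun u hu => hC _ _ _ (by simpa using mem_ball_natCast.1 hu))
    ((finite_genOne S).prod (finite_genOne S))
  rw [← Set.ncard_prod]
  have hle : (ball S (p : ℝ) ×ˢ ball S (q : ℝ)).ncard ≤ _ := (Set.ncard_le_ncard_of_injOn
    (fun x : G × G => (x.1 * (s x.1)⁻¹ * φ ^ L * (t x.2 * x.2), x.1 * (s x.1)⁻¹, s x.1, t x.2))
    ?_ ?_ hfib.1).trans hfib.2
  · refine hle.trans ?_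
    have h1 := ncard_ball_add_le H.gen (p + q) c
    rw [Set.ncard_prod]
    have h2 : p + q + c + 1 ≤ (c + 1) * (p + q + 1) := by nlinarith
    calc _ ≤ ((ball S ((p + q : ℕ) : ℝ)).ncard * (ball S (c : ℝ)).ncard) *
          ((C * ((c + 1) * (p + q + 1))) * ((genOne S).ncard * (genOne S).ncard)) := by gcongr
      _ = _ := by ring
  · rintro ⟨a, b⟩ ⟨ha, hb⟩
    have ha' := mem_ball_natCast.1 ha
    have hb' := mem_ball_natCast.1 hb
    have := H.wordLength_insert_le L a b (hs a) (ht b)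
    exact ⟨mem_ball_natCast.2 (by dsimp only at *; omega), ⟨hs' a, ht' b _⟩, hs a, ht b⟩
  · rintro ⟨a, b⟩ - ⟨a', b'⟩ - h
    simp only [Prod.mk.injEq] at h
    obtain ⟨h1, h2, h3, h4⟩ := h
    rw [h3] at h2
    have ha : a = a' := mul_right_cancel h2
    subst ha
    rw [h4] at h1
    rw [mul_left_cancel (mul_left_cancel h1)]

theorem exists_quadratic_lower_bound (H : HypAction S ρ x0 φ δ E0) (hlox : IsLoxodromic ρ x0 φ)
    (hNVC : NonVirtuallyCyclic G) (P : ℕ) :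
    P * P ≤ (ball S ((2 * wordLength S φ * P + 1 : ℕ) : ℝ)).ncard := by
  obtain ⟨s, hs, hinj⟩ := H.exists_independent hlox hNVC
  have h1 : ((Finset.range P ×ˢ Finset.range P : Finset (ℕ × ℕ)) : Set (ℕ × ℕ)).ncard ≤
      (ball S ((2 * wordLength S φ * P + 1 : ℕ) : ℝ)).ncard := by
    refine Set.ncard_le_ncard_of_injOn (fun x : ℕ × ℕ => φ ^ x.1 * s * φ ^ x.2) ?_ hinj.injOn
      (finite_ball H.gen _)
    rintro ⟨i, j⟩ hij
    simp only [Finset.coe_product, Set.mem_prod, Finset.mem_coe, Finset.mem_range] at hij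
    refine mem_ball_natCast.2 ?_
    have h2 := wordLength_mul_le H.gen (φ ^ i * s) (φ ^ j)
    have h3 := wordLength_mul_le H.gen (φ ^ i) s
    have h4 := (wordLength_pow_le H.gen φ i).trans (Nat.mul_le_mul_right _ hij.1.le)
    have h5 := (wordLength_pow_le H.gen φ j).trans (Nat.mul_le_mul_right _ hij.2.le)
    have h6 := wordLength_le_one (S := S) (Or.inl hs : s ∈ S ∨ s = 1)
    dsimp only
    have e : 2 * wordLength S φ * P = P * wordLength S φ + P * wordLength S φ := by ring
    omega
  rwa [Set.ncard_coe_finset, Finset.card_product, Finset.card_range] at h1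

end HypAction

theorem two_pow_le_of_doubling {b : ℕ → ℕ} {C : ℕ} (hC : 1 ≤ C) (hb : Monotone b)
    (hsup : ∀ p q, b p * b q ≤ C * (p + q + 1) * b (p + q)) {p : ℕ} (hp : 0 < p)
    (hp' : 8 * C * (p + 1) ≤ b p) {m : ℕ} (hm : p ≤ m) : 2 ^ m ≤ b m ^ (2 * p) := by
  have key : ∀ j : ℕ, 4 * C * (p * 2 ^ j + 1) * 2 ^ 2 ^ j ≤ b (p * 2 ^ j) := by
    intro j
    induction j with
    | zero => simpa using (by linarith : 4 * C * (p + 1) * 2 ≤ b p)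
    | succ j ih =>
      set r := p * 2 ^ j with hr
      have e1 : p * 2 ^ (j + 1) = r + r := by rw [hr]; ring
      have e2 : 2 ^ 2 ^ (j + 1) = 2 ^ 2 ^ j * 2 ^ 2 ^ j := by rw [pow_succ, ← pow_add]; ring_nf
      rw [e1, e2]
      have h1 := hsup r r
      have h2 := Nat.mul_le_mul ih ih
      have h3 : 0 < C * (r + r + 1) := by positivity
      refine Nat.le_of_mul_le_mul_left ((le_trans ?_ h2).trans h1) h3
      have h4 : (r + r + 1) * (r + r + 1) ≤ 4 * ((r + 1) * (r + 1)) := by nlinarith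
      calc C * (r + r + 1) * (4 * C * (r + r + 1) * (2 ^ 2 ^ j * 2 ^ 2 ^ j))
          = 4 * C * C * (2 ^ 2 ^ j * 2 ^ 2 ^ j) * ((r + r + 1) * (r + r + 1)) := by ring
        _ ≤ 4 * C * C * (2 ^ 2 ^ j * 2 ^ 2 ^ j) * (4 * ((r + 1) * (r + 1))) := by gcongr
        _ = _ := by ring
  have hk : m / p ≠ 0 := (Nat.div_pos hm hp).ne'
  have h1 := Nat.pow_log_le_self 2 hk
  have h2 := Nat.lt_pow_succ_log_self (b := 2) (by norm_num) (m / p)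
  set j := Nat.log 2 (m / p)
  have h3 : p * 2 ^ j ≤ m := (Nat.mul_le_mul_left _ h1).trans (Nat.mul_div_le _ _)
  have h4 : 2 ^ 2 ^ j ≤ b m := by
    refine le_trans ?_ ((key j).trans (hb h3))
    exact Nat.le_mul_of_pos_left _ (by positivity)
  have h5 : m ≤ 2 ^ j * (2 * p) := by
    have := Nat.lt_mul_of_div_lt h2 hp
    rw [pow_succ] at this
    nlinarith
  calc 2 ^ m ≤ 2 ^ (2 ^ j * (2 * p)) := Nat.pow_le_pow_right (by norm_num) h5
    _ = (2 ^ 2 ^ j) ^ (2 * p) := by rw [pow_mul]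
    _ ≤ _ := Nat.pow_le_pow_left h4 _

theorem tendsto_pow_div_of_two_pow_le {b : ℕ → ℕ} {p : ℕ} (hp : 0 < p)
    (hb : ∀ m, p ≤ m → 2 ^ m ≤ b m ^ (2 * p)) (P : ℕ) {η : ℝ} (hη : 0 < η) :
    Filter.Tendsto (fun n : ℕ => ((n : ℝ) + 1) ^ P / (b ⌊η * n⌋₊ : ℝ)) Filter.atTop (nhds 0) := by
  set r : ℝ := (2 : ℝ) ^ (1 / ((2 * p : ℕ) : ℝ)) with hr
  have hp2 : (0 : ℝ) < ((2 * p : ℕ) : ℝ) := by positivity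
  have hr1 : 1 < r := Real.one_lt_rpow (by norm_num) (by positivity)
  have hr0 : 0 < r := by linarith
  have hbr : ∀ m, p ≤ m → r ^ (m : ℝ) ≤ b m := by
    intro m hm
    have h1 : (2 : ℝ) ^ m ≤ (b m : ℝ) ^ (2 * p) := by exact_mod_cast hb m hm
    have h2 : (b m : ℝ) = ((b m : ℝ) ^ (2 * p)) ^ (1 / ((2 * p : ℕ) : ℝ)) := by
      rw [one_div, Real.pow_rpow_inv_natCast (Nat.cast_nonneg _) (by omega)]
    rw [h2, hr, ← Real.rpow_mul (by norm_num), mul_comm, Real.rpow_mul (by norm_num),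
      Real.rpow_natCast]
    exact Real.rpow_le_rpow (by positivity) h1 (by positivity)
  set c : ℝ := r ^ (-η) with hc
  have hc0 : 0 < c := Real.rpow_pos_of_pos hr0 _
  have hc1 : c < 1 := Real.rpow_lt_one_of_one_lt_of_neg hr1 (by linarith)
  have hlim := ((tendsto_pow_const_mul_const_pow_of_abs_lt_one P
    (by rwa [abs_of_pos hc0] : |c| < 1)).comp (Filter.tendsto_add_atTop_nat 1)).const_mul (r / c)
  rw [mul_zero] at hlim
  refine squeeze_zero' (Filter.Eventually.of_forall fun n => by positivity) ?_ hlim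
  have hev : ∀ᶠ n : ℕ in Filter.atTop, p ≤ ⌊η * n⌋₊ :=
    (tendsto_nat_floor_atTop.comp
      (tendsto_natCast_atTop_atTop.const_mul_atTop hη)).eventually_ge_atTop p
  filter_upwards [hev] with n hn
  have h1 : r ^ (η * n - 1) ≤ b ⌊η * n⌋₊ :=
    (Real.rpow_le_rpow_of_exponent_le hr1.le (Nat.sub_one_lt_floor _).le).trans (hbr _ hn)
  have h2 : r ^ (η * n - 1) = (r * c ^ n)⁻¹ := by
    rw [hc, ← Real.rpow_natCast, ← Real.rpow_mul hr0.le, Real.rpow_sub hr0, Real.rpow_one, neg_mul,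
      Real.rpow_neg hr0.le]
    field_simp
  rw [h2] at h1
  have h3 : ((n : ℝ) + 1) ^ P / (b ⌊η * n⌋₊ : ℝ) ≤ ((n : ℝ) + 1) ^ P / (r * c ^ n)⁻¹ := by
    gcongr
  refine h3.trans_eq ?_
  simp only [Function.comp_apply, Nat.cast_add, Nat.cast_one, pow_succ c]
  field_simp

namespace HypAction

variable {S : Finset G} {ρ : G → X → X} {x0 : X} {φ : G} {δ E0 : ℝ}

/-- Balls grow faster than any polynomial. -/
theorem tendsto_pow_div_ncard_ball (H : HypAction S ρ x0 φ δ E0) (hlox : IsLoxodromic ρ x0 φ)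
    (hNVC : NonVirtuallyCyclic G) (P : ℕ) {η : ℝ} (hη : 0 < η) :
    Filter.Tendsto (fun n : ℕ => ((n : ℝ) + 1) ^ P / ((ball S (⌊η * n⌋₊ : ℝ)).ncard : ℝ))
      Filter.atTop (nhds 0) := by
  obtain ⟨L, hL, hD, hD1⟩ : ∃ L : ℕ, 0 < L ∧ 100 * (E0 + E0 + 14 * δ) ≤ orbDist ρ x0 1 (φ ^ L) ∧
      4 ≤ orbDist ρ x0 1 (φ ^ L) :=
    ((Filter.eventually_gt_atTop 0).and
      (((H.tendsto_orbDist_pow hlox).eventually_ge_atTop _).and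
        ((H.tendsto_orbDist_pow hlox).eventually_ge_atTop _))).exists
  obtain ⟨C, hC, hsup⟩ := H.exists_supermultiplicative hL hD hD1
  set F := wordLength S φ
  set Q := 16 * C * (F + 1) with hQ
  have hgrow := H.exists_quadratic_lower_bound hlox hNVC Q
  refine tendsto_pow_div_of_two_pow_le (b := fun n => (ball S (n : ℝ)).ncard)
    (p := 2 * F * Q + 1) (by omega) (fun m hm => ?_) P hη
  refine two_pow_le_of_doubling hC (fun a b hab => ncard_ball_mono H.gen (by exact_mod_cast hab))
    hsup (by omega) (le_trans ?_ hgrow) hm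
  have h1 : 1 ≤ Q := Nat.mul_pos (by omega) (by omega)
  calc 8 * C * (2 * F * Q + 1 + 1) = 16 * C * F * Q + 16 * C * 1 := by ring
    _ ≤ 16 * C * F * Q + 16 * C * Q := by gcongr
    _ = Q * Q := by rw [hQ]; ring

end HypAction

/-! ### Aligned sequences -/

theorem isChain_singleton_append_map_range {α : Type*} {r : α → α → Prop} {a b : α} {f : ℕ → α}
    {m : ℕ} (hm : 0 < m) (h1 : r a (f 0)) (h2 : ∀ i, i + 1 < m → r (f i) (f (i + 1)))
    (h3 : r (f (m - 1)) b) : List.IsChain r ([a] ++ (List.range m).map f ++ [b]) := by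
  obtain ⟨k, rfl⟩ : ∃ k, m = k + 1 := ⟨m - 1, by omega⟩
  rw [List.isChain_append, List.isChain_append, List.isChain_map, List.isChain_range]
  refine ⟨⟨List.isChain_singleton _, fun i hi => h2 i (by omega), ?_⟩, List.isChain_singleton _, ?_⟩
  · intro x hx y hy
    simp only [List.getLast?_singleton, Option.mem_def, Option.some.injEq] at hx
    rw [List.range_succ_eq_map] at hy
    simp only [List.map_cons, List.head?_cons, Option.mem_def, Option.some.injEq] at hy
    rw [← hx, ← hy]
    exact h1
  · intro x hx y hy
    simp only [List.head?_singleton, Option.mem_def, Option.some.injEq] at hy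
    rw [List.range_succ, List.map_append, ← List.append_assoc] at hx
    simp only [List.map_cons, List.map_nil, List.getLast?_append, List.getLast?_singleton,
      Option.some_or, Option.mem_def, Option.some.injEq] at hx
    rw [← hx, ← hy]
    exact h3

/-- A sequence of segments crossed by `[x₀, u x₀]`, far apart and listed in order. -/
def SortedCrossings (S : Finset G) (ρ : G → X → X) (x0 : X) (φ : G) (E0 : ℝ) (L : ℕ) (u : G)
    (M : ℕ) (f : ℕ → G) : Prop :=
  (∀ i < M, Crossed ρ x0 (φ ^ L) E0 1 u (f i)) ∧ ∀ i j, i < j → j < M →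
    E0 + 2 * (L : ℝ) * (wordLength S φ : ℝ) < wordLength S ((f i)⁻¹ * f j) ∧
      orbDist ρ x0 1 (f i) ≤ orbDist ρ x0 1 (f j)

namespace HypAction

variable {S : Finset G} {ρ : G → X → X} {x0 : X} {φ : G} {δ E0 : ℝ}

theorem alignedPair_translate (H : HypAction S ρ x0 φ δ E0) {L : ℕ} {Υ : GeodesicSegment X}
    (hi : Υ.initial = x0) (ht : Υ.terminal = ρ (φ ^ L) x0) (hisom : ∀ g : G, Isometry (ρ g))
    {h h' : G} (h1 : orbProd ρ x0 (h * φ ^ L) h h' ≤ 3 * E0 + 24 * δ)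
    (h2 : orbProd ρ x0 (h * φ ^ L) h (h' * φ ^ L) ≤ 3 * E0 + 24 * δ)
    (h3 : orbProd ρ x0 h' h (h' * φ ^ L) ≤ 3 * E0 + 24 * δ)
    (h4 : orbProd ρ x0 h' (h * φ ^ L) (h' * φ ^ L) ≤ 3 * E0 + 24 * δ) :
    AlignedPair (6 * E0 + 300 * δ) (Υ.translate (ρ h) (hisom h)) (Υ.translate (ρ h') (hisom h')) := by
  have p0 := H.E0_pos
  have p1 := H.pos
  have ei : ∀ k, (Υ.translate (ρ k) (hisom k)).initial = ρ k x0 := fun k => by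
    rw [← hi]; rfl
  have et : ∀ k, (Υ.translate (ρ k) (hisom k)).terminal = ρ (k * φ ^ L) x0 := fun k => by
    rw [H.mul, ← ht]; rfl
  constructor
  · refine (diam_projSet_terminal_le H.hyp H.pos H.geo _ _ (A := 3 * E0 + 24 * δ) (by linarith)
      ?_ ?_).trans_lt (by linarith)
    · rw [ei, et, ei]; exact h1
    · rw [ei, et, et]; exact h2
  · refine (diam_projSet_initial_le H.hyp H.pos H.geo _ _ (A := 3 * E0 + 24 * δ) (by linarith)
      ?_ ?_).trans_lt (by linarith)
    · rw [ei, et, ei, gromovProd_comm]; exact h3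
    · rw [ei, et, et, gromovProd_comm]; exact h4

theorem alignedPair_point_translate (H : HypAction S ρ x0 φ δ E0) {L : ℕ} {Υ : GeodesicSegment X}
    (hi : Υ.initial = x0) (ht : Υ.terminal = ρ (φ ^ L) x0) (hisom : ∀ g : G, Isometry (ρ g))
    {g h : G} (h1 : orbProd ρ x0 h g (h * φ ^ L) ≤ 3 * E0 + 24 * δ) :
    AlignedPair (6 * E0 + 300 * δ) (GeodesicSegment.point (ρ g x0))
      (Υ.translate (ρ h) (hisom h)) := by
  have p0 := H.E0_pos
  have p1 := H.pos
  have ei : (Υ.translate (ρ h) (hisom h)).initial = ρ h x0 := by rw [← hi]; rfl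
  have et : (Υ.translate (ρ h) (hisom h)).terminal = ρ (h * φ ^ L) x0 := by
    rw [H.mul, ← ht]; rfl
  constructor
  · refine (projSet_point_union (ρ g x0) _ rfl).trans_lt ?_
    linarith
  · refine (diam_projSet_initial_le H.hyp H.pos H.geo _ _ (A := 3 * E0 + 24 * δ) (by linarith)
      ?_ ?_).trans_lt (by linarith)
    · rw [ei, et, gromovProd_comm]; exact h1
    · rw [ei, et, gromovProd_comm]; exact h1

theorem alignedPair_translate_point (H : HypAction S ρ x0 φ δ E0) {L : ℕ} {Υ : GeodesicSegment X}
    (hi : Υ.initial = x0) (ht : Υ.terminal = ρ (φ ^ L) x0) (hisom : ∀ g : G, Isometry (ρ g))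
    {g h : G} (h1 : orbProd ρ x0 (h * φ ^ L) h g ≤ 3 * E0 + 24 * δ) :
    AlignedPair (6 * E0 + 300 * δ) (Υ.translate (ρ h) (hisom h))
      (GeodesicSegment.point (ρ g x0)) := by
  have p0 := H.E0_pos
  have p1 := H.pos
  have ei : (Υ.translate (ρ h) (hisom h)).initial = ρ h x0 := by rw [← hi]; rfl
  have et : (Υ.translate (ρ h) (hisom h)).terminal = ρ (h * φ ^ L) x0 := by
    rw [H.mul, ← ht]; rfl
  constructor
  · refine (diam_projSet_terminal_le H.hyp H.pos H.geo _ _ (A := 3 * E0 + 24 * δ) (by linarith)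
      ?_ ?_).trans_lt (by linarith)
    · rw [ei, et]; exact h1
    · rw [ei, et]; exact h1
  · refine (projSet_point_union (ρ g x0) _ rfl).trans_lt ?_
    linarith

theorem mem_Vset_of_sortedCrossings (H : HypAction S ρ x0 φ δ E0) {L : ℕ} (hL : 0 < L)
    (hD : 100 * (E0 + E0 + 14 * δ) ≤ orbDist ρ x0 1 (φ ^ L)) {Υ : GeodesicSegment X}
    (hi : Υ.initial = x0) (ht : Υ.terminal = ρ (φ ^ L) x0) (hisom : ∀ g : G, Isometry (ρ g))
    {ε : ℝ} {n : ℕ} (hm : 0 < ⌈ε * (n : ℝ)⌉₊) {u k : G} {f : ℕ → G}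
    (hf : SortedCrossings S ρ x0 φ E0 L u ⌈ε * (n : ℝ)⌉₊ f)
    (hstart : orbProd ρ x0 (f 0) k⁻¹ (f 0 * φ ^ L) ≤ 3 * E0 + 24 * δ)
    (hk : k * u ∈ ball S (n : ℝ)) : k * u ∈ Vset S ρ hisom x0 δ E0 Υ ε n := by
  have p0 := H.E0_pos
  have p1 := H.pos
  refine ⟨hk, fun i => k * f (i - 1), ?_⟩
  rw [AlignedSeq, transList]
  refine isChain_singleton_append_map_range hm ?_ (fun i hi' => ?_) ?_
  · have h1 := H.alignedPair_point_translate hi ht hisom (g := 1) (h := k * f 0) (by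
      rw [← H.orbProd_mul_left k, mul_inv_cancel, ← mul_assoc] at hstart
      exact hstart)
    rw [H.one] at h1
    exact h1
  · obtain ⟨h1, h2⟩ := hf.2 i (i + 1) (by omega) hi'
    obtain ⟨-, h3, h4, h5, h6⟩ := H.ordered hL H.E0_pos.le hD (hf.1 i (by omega)) (hf.1 _ hi') h1 h2
    refine H.alignedPair_translate hi ht hisom ?_ ?_ ?_ ?_ <;>
    · simp only [Nat.add_sub_cancel]
      rw [mul_assoc k]
      try rw [mul_assoc k]
      rw [H.orbProd_mul_left]
      linarith
  · have h1 := hf.1 (⌈ε * (n : ℝ)⌉₊ - 1) (by omega)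
    refine H.alignedPair_translate_point hi ht hisom ?_
    simp only [Nat.add_sub_cancel]
    rw [mul_assoc k, H.orbProd_mul_left]
    linarith [h1.2]

end HypAction

/-! ### Insertions -/

/-- Replacing a piece of `g`, at level `α` in the word metric, by `φ ^ L` gives the element `u`,
and `[x₀, u x₀]` crosses the segment starting at `h`. -/
structure Insertion (S : Finset G) (ρ : G → X → X) (x0 : X) (φ : G) (E0 : ℝ) (L n α : ℕ)
    (g u h a κ b : G) : Prop where
  length_eq : wordLength S a = α
  near : wordLength S (a⁻¹ * h) ≤ 1
  add_le : α + (L * wordLength S φ + 2) + wordLength S b ≤ n + 1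
  length_le : wordLength S κ ≤ L * wordLength S φ + 4
  length_mul_le : wordLength S (h * κ) ≤ α + (L * wordLength S φ + 2) + 1
  eq_new : h * φ ^ L * b = u
  eq_old : h * κ * b = g
  crossed : Crossed ρ x0 (φ ^ L) E0 1 u h

theorem HypAction.exists_insertion {S : Finset G} {ρ : G → X → X} {x0 : X} {φ : G} {δ E0 : ℝ}
    (H : HypAction S ρ x0 φ δ E0) {L : ℕ} (hL : 0 < L) {n α : ℕ} {g : G}
    (hα : α + (L * wordLength S φ + 2) ≤ wordLength S g) (hg : wordLength S g ≤ n) :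
    ∃ u h a κ b, Insertion S ρ x0 φ E0 L n α g u h a κ b := by
  obtain ⟨a, d, had, ha, hd⟩ := exists_split H.gen g (i := α) (by omega)
  obtain ⟨c, b, hcb, hc, hb⟩ := exists_split H.gen d (i := L * wordLength S φ + 2) (by omega)
  obtain ⟨s, hs, hs'⟩ := H.exists_left hL a
  obtain ⟨t, ht, ht'⟩ := H.exists_right hL b
  have hs1 := wordLength_le_one hs
  have ht1 := wordLength_le_one ht
  refine ⟨_, a * s⁻¹, a, s * c * t⁻¹, t * b, ha, ?_, ?_, ?_, ?_, rfl, ?_, hs', ht' _⟩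
  · rw [inv_mul_cancel_left, wordLength_inv H.gen]
    exact hs1
  · have := wordLength_mul_le H.gen t b
    omega
  · have h1 := wordLength_mul_le H.gen (s * c) t⁻¹
    have h2 := wordLength_mul_le H.gen s c
    rw [wordLength_inv H.gen] at h1
    omega
  · have e : a * s⁻¹ * (s * c * t⁻¹) = a * c * t⁻¹ := by group
    have h1 := wordLength_mul_le H.gen (a * c) t⁻¹
    have h2 := wordLength_mul_le H.gen a c
    rw [wordLength_inv H.gen] at h1
    rw [e]
    omega
  · rw [← had, ← hcb]
    group

namespace Insertion

variable {S : Finset G} {ρ : G → X → X} {x0 : X} {φ : G} {δ E0 : ℝ} {L n α : ℕ}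
  {g u h a κ b : G}

theorem wordLength_le (I : Insertion S ρ x0 φ E0 L n α g u h a κ b)
    (H : HypAction S ρ x0 φ δ E0) : wordLength S h ≤ α + 1 := by
  have h1 := wordLength_mul_le H.gen a (a⁻¹ * h)
  rw [mul_inv_cancel_left] at h1
  have h2 := I.near
  have h3 := I.length_eq
  omega

theorem le_wordLength (I : Insertion S ρ x0 φ E0 L n α g u h a κ b)
    (H : HypAction S ρ x0 φ δ E0) : α ≤ wordLength S h + 1 := by
  have h1 := wordLength_mul_le H.gen h (a⁻¹ * h)⁻¹
  rw [wordLength_inv H.gen, mul_inv_rev, inv_inv, mul_inv_cancel_left] at h1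
  have h2 := I.near
  have h3 := I.length_eq
  omega

theorem mem_ball (I : Insertion S ρ x0 φ E0 L n α g u h a κ b)
    (H : HypAction S ρ x0 φ δ E0) : u ∈ ball S (n : ℝ) := by
  refine mem_ball_natCast.2 ?_
  have h1 := wordLength_mul_le H.gen (h * φ ^ L) b
  have h2 := wordLength_mul_le H.gen h (φ ^ L)
  have h3 := wordLength_pow_le H.gen φ L
  have h4 := I.wordLength_le H
  have h5 := I.add_le
  rw [I.eq_new] at h1
  omega

theorem eq_mul (I : Insertion S ρ x0 φ E0 L n α g u h a κ b) :
    g = h * κ * (φ ^ L)⁻¹ * h⁻¹ * u := by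
  rw [← I.eq_new, ← I.eq_old]
  group

end Insertion

/-- The starting points of the segments inserted into elements of `B` with result `u`. -/
def insertionSet (S : Finset G) (ρ : G → X → X) (x0 : X) (φ : G) (E0 : ℝ) (L n : ℕ) (B : Set G)
    (u : G) : Set G :=
  {h | ∃ g ∈ B, ∃ α a κ b, Insertion S ρ x0 φ E0 L n α g u h a κ b}

/-- The elements arising from insertions at `M` places far away from each other. -/
def manyInsertions (S : Finset G) (ρ : G → X → X) (x0 : X) (φ : G) (E0 : ℝ) (L n : ℕ) (B : Set G)
    (M : ℕ) : Set G :=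
  {u | ∃ f : ℕ → G, SortedCrossings S ρ x0 φ E0 L u M f ∧
    ∀ i < M, f i ∈ insertionSet S ρ x0 φ E0 L n B u}

namespace HypAction

variable {S : Finset G} {ρ : G → X → X} {x0 : X} {φ : G} {δ E0 : ℝ}

theorem insertionSet_subset (L n : ℕ) (B : Set G) (u : G) :
    insertionSet S ρ x0 φ E0 L n B u ⊆ {h | Crossed ρ x0 (φ ^ L) E0 1 u h} := by
  rintro h ⟨g, -, α, a, κ, b, I⟩
  exact I.crossed

theorem ncard_insertionSet_le (H : HypAction S ρ x0 φ δ E0) {L n M : ℕ} {B : Set G} {u : G}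
    (hu : u ∉ manyInsertions S ρ x0 φ E0 L n B (M + 1)) :
    (insertionSet S ρ x0 φ E0 L n B u).Finite ∧ (insertionSet S ρ x0 φ E0 L n B u).ncard ≤
      M * (ball S (E0 + 2 * (L : ℝ) * (wordLength S φ : ℝ))).ncard := by
  have h0 := H.E0_pos
  refine finite_and_ncard_le_of_separated H.gen _ (by positivity) _ _ fun T hT hsep => ?_
  by_contra hcard
  obtain ⟨f, hf, hf'⟩ := exists_sorted_enumeration T (orbDist ρ x0 1)
  have hfT : ∀ i < M + 1, f i ∈ T := fun i hi => hf i (by omega)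
  refine hu ⟨f, ⟨fun i hi => insertionSet_subset _ _ _ _ (hT (hfT i hi)), fun i j hij hj => ?_⟩,
    fun i hi => hT (hfT i hi)⟩
  obtain ⟨h1, h2⟩ := hf' i j hij (by omega)
  exact ⟨hsep _ (hfT i (hij.trans hj)) _ (hfT j hj) h1, h2⟩

theorem orbDist_le_of_sortedCrossings (H : HypAction S ρ x0 φ δ E0) {L : ℕ} (hL : 0 < L)
    (hD : 100 * (E0 + E0 + 14 * δ) ≤ orbDist ρ x0 1 (φ ^ L)) {u : G} {M : ℕ} {f : ℕ → G}
    (hf : SortedCrossings S ρ x0 φ E0 L u M f) (i j : ℕ) (hij : i + j < M) :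
    orbDist ρ x0 1 (f i) + j * (3 / 4 * orbDist ρ x0 1 (φ ^ L)) ≤ orbDist ρ x0 1 (f (i + j)) := by
  induction j with
  | zero => simp
  | succ j ih =>
    have h1 := ih (by omega)
    obtain ⟨h2, h3⟩ := hf.2 (i + j) (i + (j + 1)) (by omega) hij
    have h4 := (H.ordered hL H.E0_pos.le hD (hf.1 _ (by omega)) (hf.1 _ hij) h2 h3).1
    push_cast
    linarith

theorem orbDist_mul_pow (H : HypAction S ρ x0 φ δ E0) (L : ℕ) (h : G) :
    orbDist ρ x0 h (h * φ ^ L) = orbDist ρ x0 1 (φ ^ L) := by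
  rw [← H.orbDist_mul_left h 1, mul_one]

theorem le_orbDist_of_sortedCrossings (H : HypAction S ρ x0 φ δ E0) {L : ℕ} (hL : 0 < L)
    (hD : 100 * (E0 + E0 + 14 * δ) ≤ orbDist ρ x0 1 (φ ^ L)) {u : G} {M : ℕ} {f : ℕ → G}
    (hf : SortedCrossings S ρ x0 φ E0 L u M f) (i j : ℕ) (hij : i + j < M) :
    j * (3 / 4 * orbDist ρ x0 1 (φ ^ L)) - orbDist ρ x0 1 (φ ^ L) ≤
      orbDist ρ x0 (f i * φ ^ L) (f (i + j)) := by
  have h1 := H.orbDist_le_of_sortedCrossings hL hD hf i j hij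
  have h2 := H.orbDist_mul_pow L (f i)
  have h3 := dist_triangle4 (ρ 1 x0) (ρ (f i) x0) (ρ (f i * φ ^ L) x0) (ρ (f (i + j)) x0)
  simp only [orbDist] at *
  linarith

/-- If `y` projects to a late segment away from its initial point, then seen from an earlier segment
it lies in the direction of `u`. -/
theorem orbProd_le_of_lt (H : HypAction S ρ x0 φ δ E0) {L : ℕ} (hL : 0 < L)
    (hD : 10000 * (E0 + δ) ≤ orbDist ρ x0 1 (φ ^ L)) {u y : G} {M : ℕ} {f : ℕ → G}
    (hf : SortedCrossings S ρ x0 φ E0 L u M f) {k : ℕ} (hk : k + 2 < M)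
    (hy : 3 * E0 + 24 * δ < orbProd ρ x0 (f (k + 2)) y (f (k + 2) * φ ^ L)) :
    orbProd ρ x0 (f k * φ ^ L) (f k) y ≤ 2 * E0 + 20 * δ := by
  have p0 := H.E0_pos
  have p1 := H.pos
  have hD' : 100 * (E0 + E0 + 14 * δ) ≤ orbDist ρ x0 1 (φ ^ L) := by linarith
  obtain ⟨h1, h2⟩ := hf.2 k (k + 2) (by omega) hk
  obtain ⟨-, -, -, h3, h4⟩ := H.ordered hL H.E0_pos.le hD' (hf.1 k (by omega)) (hf.1 _ hk) h1 h2
  have h5 := H.le_orbDist_of_sortedCrossings hL hD' hf k 2 hk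
  have h6 := gromovProd_add (ρ (f k * φ ^ L) x0) (ρ y x0) (ρ (f (k + 2)) x0)
  simp only [orbProd, orbDist] at *
  rcases H.fourPoint (ρ (f (k + 2)) x0) (ρ (f k * φ ^ L) x0) (ρ (f (k + 2) * φ ^ L) x0) (ρ y x0)
    with h7 | h7
  · rcases H.fourPoint (ρ (f k * φ ^ L) x0) (ρ (f k) x0) (ρ (f (k + 2)) x0) (ρ y x0) with h8 | h8
    · linarith
    · rw [gromovProd_comm (ρ (f k * φ ^ L) x0)] at h8
      push_cast at h5
      linarith
  · linarith

theorem crossed_of_sortedCrossings (H : HypAction S ρ x0 φ δ E0) {L : ℕ} (hL : 0 < L)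
    (hD : 10000 * (E0 + δ) ≤ orbDist ρ x0 1 (φ ^ L)) {u w : G} {M : ℕ} {f : ℕ → G}
    (hf : SortedCrossings S ρ x0 φ E0 L u M f) {k : ℕ} (hk0 : 0 < k) (hk : k < M)
    (hw : orbDist ρ x0 w (f k) + 2 * E0 + 20 * δ < orbDist ρ x0 (f 0 * φ ^ L) (f k)) :
    Crossed ρ x0 (φ ^ L) (2 * E0 + 20 * δ) 1 w (f 0) := by
  have p0 := H.E0_pos
  have p1 := H.pos
  have hc := hf.1 0 (by omega)
  obtain ⟨h1, h2⟩ := hf.2 0 k hk0 hk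
  obtain ⟨-, -, -, h3, -⟩ := H.ordered hL p0.le (by linarith) hc (hf.1 k hk) h1 h2
  refine ⟨by linarith [hc.1], ?_⟩
  simp only [orbProd, orbDist] at *
  rcases H.fourPoint (ρ (f 0 * φ ^ L) x0) (ρ (f 0) x0) (ρ (f k) x0) (ρ w x0) with h4 | h4
  · linarith
  · have h5 := dist_triangle (ρ (f 0 * φ ^ L) x0) (ρ w x0) (ρ (f k) x0)
    rw [gromovProd, dist_comm (ρ w x0) (ρ (f 0 * φ ^ L) x0)] at h4
    linarith

theorem crossed_translate_of_sortedCrossings (H : HypAction S ρ x0 φ δ E0) {L : ℕ} (hL : 0 < L)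
    (hD : 10000 * (E0 + δ) ≤ orbDist ρ x0 1 (φ ^ L)) {u z : G} {M : ℕ} {f : ℕ → G}
    (hf : SortedCrossings S ρ x0 φ E0 L u M f) {k : ℕ} (hk0 : 0 < k) (hk : k + 2 < M)
    (hz : 3 * E0 + 24 * δ < orbProd ρ x0 (f (k + 2)) z⁻¹ (f (k + 2) * φ ^ L)) :
    Crossed ρ x0 (φ ^ L) (2 * E0 + 20 * δ) (z * (f 0 * φ ^ L)) 1 (z * f k) := by
  have p0 := H.E0_pos
  have p1 := H.pos
  obtain ⟨h1, h2⟩ := hf.2 0 k hk0 (by omega)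
  obtain ⟨-, -, -, -, h3⟩ := H.ordered hL p0.le (by linarith) (hf.1 0 (by omega))
    (hf.1 k (by omega)) h1 h2
  rw [← mul_inv_cancel z, H.crossed_mul_left]
  exact ⟨by linarith, H.orbProd_le_of_lt hL hD hf hk hz⟩

theorem exists_of_mem_manyInsertions (H : HypAction S ρ x0 φ δ E0) {L : ℕ} (hL : 0 < L)
    (hD : 10000 * (E0 + δ) ≤ orbDist ρ x0 1 (φ ^ L)) {K : ℕ}
    (hK : ∀ g h : G, orbDist ρ x0 g h ≤ K * wordLength S (g⁻¹ * h))
    (hDK : 8 * (K : ℝ) + 4 ≤ orbDist ρ x0 1 (φ ^ L)) {Υ : GeodesicSegment X}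
    (hi : Υ.initial = x0) (ht : Υ.terminal = ρ (φ ^ L) x0) (hisom : ∀ g : G, Isometry (ρ g))
    {ε : ℝ} {n m e : ℕ} (hmε : ⌈ε * (n : ℝ)⌉₊ = m) (hm : 0 < m) (he : 2 * e ≤ m) {u : G}
    (hu : u ∈ manyInsertions S ρ x0 φ E0 L n (BADset S ρ hisom x0 δ E0 Υ ε n) (2 * m + 3)) :
    ∃ p q, p + q + e = n + 1 ∧ ∃ w b κ h : G, wordLength S w ≤ p ∧ wordLength S b ≤ q ∧
      wordLength S κ ≤ L * wordLength S φ + 4 ∧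
      (Crossed ρ x0 (φ ^ L) (2 * E0 + 20 * δ) 1 w h ∧ h * φ ^ L * b = u ∨
        Crossed ρ x0 (φ ^ L) (2 * E0 + 20 * δ) w 1 h ∧
          w * κ⁻¹ * φ ^ L * w⁻¹ * (h * φ ^ L * b) = u) := by
  have p0 := H.E0_pos
  have p1 := H.pos
  have hD' : 100 * (E0 + E0 + 14 * δ) ≤ orbDist ρ x0 1 (φ ^ L) := by linarith
  obtain ⟨f, hf, hfI⟩ := hu
  obtain ⟨g, hg, α, a, κ, b, I⟩ := hfI 0 (by omega)
  obtain ⟨g', -, α', a', κ', b', I'⟩ := hfI (m + 1) (by omega)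
  have hm1 : (1 : ℝ) ≤ m := by exact_mod_cast hm
  have hκ1 := I.add_le
  have hκ2 := I'.add_le
  rcases Nat.lt_or_ge (α + e) α' with hα | hα
  · refine ⟨n + 1 - e - wordLength S b', wordLength S b', by omega, f 0 * κ, b', κ,
      f 0 * κ * (φ ^ L)⁻¹ * (f 0)⁻¹ * f (m + 1), ?_, le_rfl, I.length_le, Or.inr ⟨?_, ?_⟩⟩
    · have := I.length_mul_le
      omega
    · have h1 := H.crossed_translate_of_sortedCrossings hL hD hf (k := m + 1) (by omega) (by omega)
        (z := f 0 * κ * (φ ^ L)⁻¹ * (f 0)⁻¹) ?_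
      · convert h1 using 1
        group
      · by_contra hcon
        refine hg.2 (Or.inr ?_)
        rw [I.eq_mul]
        refine H.mem_Vset_of_sortedCrossings hL hD' hi ht hisom (hmε ▸ hm)
          (f := fun i => f (m + 1 + 2 + i)) ⟨fun i hi => hf.1 _ ?_, fun i j hij hj => hf.2 _ _ ?_ ?_⟩
          (not_lt.1 hcon) ?_
        · omega
        · omega
        · omega
        · rw [← I.eq_mul]
          exact hg.1
    · rw [← I'.eq_new]
      group
  · have hlen := H.orbDist_le_of_sortedCrossings hL hD' hf 0 (m + 1) (by omega)
    have hfar := H.le_orbDist_of_sortedCrossings hL hD' hf 0 (m + 1) (by omega)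
    rw [zero_add] at hlen hfar
    push_cast at hlen hfar
    have hmD : (m : ℝ) * (8 * (K : ℝ) + 4) ≤ m * orbDist ρ x0 1 (φ ^ L) := by gcongr
    have hmD' : (m : ℝ) * (10000 * (E0 + δ)) ≤ m * orbDist ρ x0 1 (φ ^ L) := by gcongr
    have hmD1 : orbDist ρ x0 1 (φ ^ L) ≤ m * orbDist ρ x0 1 (φ ^ L) :=
      le_mul_of_one_le_left (orbDist_nonneg ..) hm1
    have hmE : E0 + δ ≤ m * (E0 + δ) := le_mul_of_one_le_left (by linarith) hm1
    have hmK : (K : ℝ) ≤ m * K := le_mul_of_one_le_left (by positivity) hm1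
    have hα' : 2 * e ≤ α' := by
      by_contra hcon
      have h1 := hK 1 (f (m + 1))
      rw [inv_one, one_mul] at h1
      have h2 := I'.wordLength_le H
      have h3 : (wordLength S (f (m + 1)) : ℝ) ≤ m := by exact_mod_cast (by omega)
      have h4 : (K : ℝ) * wordLength S (f (m + 1)) ≤ K * m := by gcongr
      have h5 := orbDist_nonneg ρ x0 1 (f 0)
      nlinarith
    obtain ⟨w, r, hwr, hw, hr⟩ := exists_split H.gen a' (i := α' - 2 * e) (by
      rw [I'.length_eq]; omega)
    rw [I'.length_eq] at hr
    refine ⟨n + 1 - e - wordLength S b, wordLength S b, by omega, w, b, κ, f 0, by omega, le_rfl,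
      I.length_le, Or.inl ⟨?_, I.eq_new⟩⟩
    refine H.crossed_of_sortedCrossings hL hD hf (k := m + 1) (by omega) (by omega) ?_
    have h1 := hK w (f (m + 1))
    have h2 := wordLength_mul_le H.gen r (a'⁻¹ * f (m + 1))
    have h3 := I'.near
    have e1 : r * (a'⁻¹ * f (m + 1)) = w⁻¹ * f (m + 1) := by rw [← hwr]; group
    rw [e1] at h2
    have h4 : (wordLength S (w⁻¹ * f (m + 1)) : ℝ) ≤ m + 1 := by exact_mod_cast (by omega)
    have h5 : (K : ℝ) * wordLength S (w⁻¹ * f (m + 1)) ≤ K * (m + 1) := by gcongr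
    linarith

/-- Elements with many insertions are negligible. -/
theorem exists_ncard_manyInsertions_le (H : HypAction S ρ x0 φ δ E0) {L : ℕ} (hL : 0 < L)
    (hD : 10000 * (E0 + δ) ≤ orbDist ρ x0 1 (φ ^ L)) {K : ℕ}
    (hK : ∀ g h : G, orbDist ρ x0 g h ≤ K * wordLength S (g⁻¹ * h))
    (hDK : 8 * (K : ℝ) + 4 ≤ orbDist ρ x0 1 (φ ^ L)) {Υ : GeodesicSegment X}
    (hi : Υ.initial = x0) (ht : Υ.terminal = ρ (φ ^ L) x0) (hisom : ∀ g : G, Isometry (ρ g)) :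
    ∃ C : ℕ, ∀ (ε : ℝ) (n m e : ℕ), ⌈ε * (n : ℝ)⌉₊ = m → 0 < m → 2 * e ≤ m →
      (manyInsertions S ρ x0 φ E0 L n (BADset S ρ hisom x0 δ E0 Υ ε n) (2 * m + 3)).ncard *
        (ball S (e : ℝ)).ncard ≤ C * (n + 2) ^ 4 * (ball S (n : ℝ)).ncard := by
  have p0 := H.E0_pos
  have p1 := H.pos
  have hD1 : 4 ≤ orbDist ρ x0 1 (φ ^ L) := by linarith [(Nat.cast_nonneg K : (0 : ℝ) ≤ K)]
  obtain ⟨C, -, hC⟩ := H.exists_crossed_bound hL (e := 2 * E0 + 20 * δ) (by positivity)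
    (by linarith) hD1
  obtain ⟨C', -, hC'⟩ := H.exists_supermultiplicative hL (by linarith) hD1
  set c := L * wordLength S φ + 4
  set b : ℕ → ℕ := fun n => (ball S (n : ℝ)).ncard with hb
  refine ⟨4 * C * b c * C' * C' * b 1, fun ε n m e hmε hm he => ?_⟩
  set T := manyInsertions S ρ x0 φ E0 L n (BADset S ρ hisom x0 δ E0 Υ ε n) (2 * m + 3)
  rcases Nat.lt_or_ge (n + 1) e with hen | hen
  · have hT : T = ∅ := by
      refine Set.eq_empty_of_forall_notMem fun u hu => ?_
      obtain ⟨p, q, hpq, -⟩ := H.exists_of_mem_manyInsertions hL hD hK hDK hi ht hisom hmε hm he hu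
      omega
    rw [hT, Set.ncard_empty, zero_mul]
    exact Nat.zero_le _
  obtain ⟨r, hr⟩ : ∃ r, n + 1 = r + e := ⟨n + 1 - e, by omega⟩
  let F : G → Set G := fun w => {h | Crossed ρ x0 (φ ^ L) (2 * E0 + 20 * δ) 1 w h} ∪
    {h | Crossed ρ x0 (φ ^ L) (2 * E0 + 20 * δ) w 1 h}
  have hF : ∀ p ≤ n + 1, ∀ w ∈ ball S (p : ℝ), (F w).Finite ∧ (F w).ncard ≤ 2 * C * (n + 2) := by
    intro p hp w hw
    have hw' := mem_ball_natCast.1 hw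
    obtain ⟨h1, h2⟩ := hC (n + 1) 1 w (by rw [inv_one, one_mul]; omega)
    obtain ⟨h3, h4⟩ := hC (n + 1) w 1 (by rw [mul_one, wordLength_inv H.gen]; omega)
    refine ⟨h1.union h3, (Set.ncard_union_le _ _).trans ?_⟩
    linarith
  let A : ℕ → Set (G × G × (G × G)) := fun p => {x | x.1 ∈ ball S (p : ℝ) ∧ x.2.1 ∈ F x.1 ∧
    x.2.2 ∈ ball S (c : ℝ) ×ˢ ball S ((r - p : ℕ) : ℝ)}
  have hA : ∀ p ≤ n + 1, (A p).Finite ∧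
      (A p).ncard ≤ b p * (2 * C * (n + 2) * (b c * b (r - p))) := fun p hp => by
    rw [hb, ← Set.ncard_prod]
    exact finite_and_ncard_fiber_le (finite_ball H.gen _) (hF p hp)
      ((finite_ball H.gen _).prod (finite_ball H.gen _))
  let Ψ : G × G × (G × G) → G := fun x => x.2.1 * φ ^ L * x.2.2.2
  let Ψ' : G × G × (G × G) → G := fun x =>
    x.1 * x.2.2.1⁻¹ * φ ^ L * x.1⁻¹ * (x.2.1 * φ ^ L * x.2.2.2)
  have hsub : T ⊆ ⋃ p ∈ Finset.range (r + 1), (Ψ '' A p ∪ Ψ' '' A p) := by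
    intro u hu
    obtain ⟨p, q, hpq, w, y, κ, h, hw, hy, hκ, hwh⟩ :=
      H.exists_of_mem_manyInsertions hL hD hK hDK hi ht hisom hmε hm he hu
    simp only [Set.mem_iUnion]
    refine ⟨p, Finset.mem_range.2 (by omega), ?_⟩
    have hx : h ∈ F w → (w, h, κ, y) ∈ A p := fun hh => ⟨mem_ball_natCast.2 hw, hh,
      mem_ball_natCast.2 hκ, mem_ball_natCast.2 (by dsimp only; omega)⟩
    rcases hwh with ⟨h1, h2⟩ | ⟨h1, h2⟩
    · exact Or.inl ⟨_, hx (Or.inl h1), h2⟩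
    · exact Or.inr ⟨_, hx (Or.inr h1), h2⟩
  have hfin : (⋃ p ∈ Finset.range (r + 1), (Ψ '' A p ∪ Ψ' '' A p)).Finite :=
    (Finset.range (r + 1)).finite_toSet.biUnion fun p hp => by
      have hp' := Finset.mem_range.1 hp
      have := (hA p (by omega)).1
      exact (this.image _).union (this.image _)
  have hT : T.ncard ≤ (r + 1) * (4 * C * (n + 2) * b c * (C' * (r + 1) * b r)) := by
    refine (Set.ncard_le_ncard hsub hfin).trans ((Finset.set_ncard_biUnion_le _ _).trans ?_)
    refine (Finset.sum_le_card_nsmul _ _ _ fun p hp => ?_).trans_eq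
      (by rw [Finset.card_range, smul_eq_mul])
    have hp' := Finset.mem_range.1 hp
    obtain ⟨h1, h2⟩ := hA p (by omega)
    have h3 := hC' p (r - p)
    rw [Nat.add_sub_cancel' (by omega)] at h3
    calc _ ≤ (A p).ncard + (A p).ncard := (Set.ncard_union_le _ _).trans
          (add_le_add (Set.ncard_image_le h1) (Set.ncard_image_le h1))
      _ ≤ 2 * (b p * (2 * C * (n + 2) * (b c * b (r - p)))) := by omega
      _ = 4 * C * (n + 2) * b c * (b p * b (r - p)) := by ring
      _ ≤ _ := Nat.mul_le_mul_left _ h3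
  have hrn : r + 1 ≤ n + 2 := by omega
  have h1 := hC' r e
  have h2 := ncard_ball_add_le H.gen n 1
  rw [← hr] at h1
  calc T.ncard * b e ≤ (r + 1) * (4 * C * (n + 2) * b c * (C' * (r + 1) * b r)) * b e := by gcongr
    _ = (r + 1) * (4 * C * (n + 2) * b c * (C' * (r + 1))) * (b r * b e) := by ring
    _ ≤ (r + 1) * (4 * C * (n + 2) * b c * (C' * (r + 1))) *
        (C' * (n + 1 + 1) * (b n * b 1)) :=
      Nat.mul_le_mul_left _ (h1.trans (Nat.mul_le_mul_left _ h2))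
    _ ≤ (n + 2) * (4 * C * (n + 2) * b c * (C' * (n + 2))) * (C' * (n + 1 + 1) * (b n * b 1)) := by
      gcongr
    _ = _ := by ring

/-- Counting pairs consisting of an element of `B` and a level at which to insert. -/
theorem ncard_mul_le (H : HypAction S ρ x0 φ δ E0) {L : ℕ} (hL : 0 < L) {n N M C : ℕ} {B : Set G}
    (hC : ∀ u : G, wordLength S u ≤ n → {h | Crossed ρ x0 (φ ^ L) E0 1 u h}.Finite ∧
      {h | Crossed ρ x0 (φ ^ L) E0 1 u h}.ncard ≤ C)
    (hB : ∀ g ∈ B, wordLength S g ≤ n ∧ N + (L * wordLength S φ + 2) ≤ wordLength S g) :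
    B.ncard * N ≤ ((ball S (n : ℝ)).ncard *
        (M * (ball S (E0 + 2 * (L : ℝ) * (wordLength S φ : ℝ))).ncard) +
        (manyInsertions S ρ x0 φ E0 L n B (M + 1)).ncard * C) *
      ((ball S ((L * wordLength S φ + 4 : ℕ) : ℝ)).ncard * 3) := by
  classical
  set T := manyInsertions S ρ x0 φ E0 L n B (M + 1)
  set I := insertionSet S ρ x0 φ E0 L n B
  set E : Set (G × ℕ) := ball S ((L * wordLength S φ + 4 : ℕ) : ℝ) ×ˢ (Finset.range 3 : Set ℕ)
  have hE : E.Finite := (finite_ball H.gen _).prod (Finset.finite_toSet _)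
  have hEc : E.ncard = (ball S ((L * wordLength S φ + 4 : ℕ) : ℝ)).ncard * 3 := by
    rw [Set.ncard_prod, Set.ncard_coe_finset, Finset.card_range]
  have hball := finite_ball H.gen (n : ℝ)
  have hTb : T ⊆ ball S (n : ℝ) := by
    rintro u ⟨f, -, hf⟩
    obtain ⟨g, -, α, a, κ, b, J⟩ := hf 0 (by omega)
    exact J.mem_ball H
  have hT : T.Finite := hball.subset hTb
  obtain ⟨f1, c1⟩ := finite_and_ncard_fiber_le (hball.sdiff (t := T)) (F := I)
    (fun u hu => H.ncard_insertionSet_le hu.2) hE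
  obtain ⟨f2, c2⟩ := finite_and_ncard_fiber_le hT (F := I) (N := C) (fun u hu => by
    obtain ⟨h1, h2⟩ := hC u (mem_ball_natCast.1 (hTb hu))
    exact ⟨h1.subset (insertionSet_subset _ _ _ _),
      (Set.ncard_le_ncard (insertionSet_subset _ _ _ _) h1).trans h2⟩) hE
  have hex : ∀ x : G × ℕ, ∃ y : G × G × G × G × G, x ∈ B ×ˢ (Finset.range N : Set ℕ) →
      Insertion S ρ x0 φ E0 L n x.2 x.1 y.1 y.2.1 y.2.2.1 y.2.2.2.1 y.2.2.2.2 := by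
    intro x
    by_cases hx : x ∈ B ×ˢ (Finset.range N : Set ℕ)
    · obtain ⟨h1, h2⟩ := hB x.1 hx.1
      have h3 := Finset.mem_range.1 (Finset.mem_coe.1 hx.2)
      obtain ⟨u, h, a, κ, b, J⟩ := H.exists_insertion hL (α := x.2) (by omega) h1
      exact ⟨(u, h, a, κ, b), fun _ => J⟩
    · exact ⟨(1, 1, 1, 1, 1), fun h => absurd h hx⟩
  choose y hy using hex
  have hle := Set.ncard_le_ncard_of_injOn (s := B ×ˢ (Finset.range N : Set ℕ))
    (fun x => ((y x).1, (y x).2.1, ((y x).2.2.2.1, x.2 + 1 - wordLength S (y x).2.1)))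
    (t := {x : G × G × (G × ℕ) | x.1 ∈ ball S (n : ℝ) \ T ∧ x.2.1 ∈ I x.1 ∧ x.2.2 ∈ E} ∪
      {x : G × G × (G × ℕ) | x.1 ∈ T ∧ x.2.1 ∈ I x.1 ∧ x.2.2 ∈ E}) ?_ ?_
    (f1.union f2)
  · rw [Set.ncard_prod, Set.ncard_coe_finset, Finset.card_range] at hle
    refine hle.trans ((Set.ncard_union_le _ _).trans ((add_le_add c1 c2).trans ?_))
    have h1 := Set.ncard_le_ncard (Set.sdiff_subset (s := ball S (n : ℝ)) (t := T)) hball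
    rw [hEc]
    calc _ ≤ (ball S (n : ℝ)).ncard * (M * (ball S (E0 + 2 * (L : ℝ) * (wordLength S φ : ℝ))).ncard *
            ((ball S ((L * wordLength S φ + 4 : ℕ) : ℝ)).ncard * 3)) +
          T.ncard * (C * ((ball S ((L * wordLength S φ + 4 : ℕ) : ℝ)).ncard * 3)) := by gcongr
      _ = _ := by ring
  · intro x hx
    have J := hy x hx
    have h1 : (y x).2.1 ∈ I (y x).1 := ⟨x.1, hx.1, _, _, _, _, J⟩
    have h2 : ((y x).2.2.2.1, x.2 + 1 - wordLength S (y x).2.1) ∈ E := by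
      refine ⟨mem_ball_natCast.2 J.length_le, Finset.mem_coe.2 (Finset.mem_range.2 ?_)⟩
      have := J.le_wordLength H
      dsimp only
      omega
    by_cases h3 : (y x).1 ∈ T
    · exact Or.inr ⟨h3, h1, h2⟩
    · exact Or.inl ⟨⟨J.mem_ball H, h3⟩, h1, h2⟩
  · intro x hx x' hx' hxx
    have J := hy x hx
    have J' := hy x' hx'
    simp only [Prod.mk.injEq] at hxx
    obtain ⟨h1, h2, h3, h4⟩ := hxx
    have l1 := J.wordLength_le H
    have l2 := J'.wordLength_le H
    refine Prod.ext ?_ ?_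
    · rw [J.eq_mul, J'.eq_mul, h1, h2, h3]
    · rw [h2] at h4 l1
      omega

theorem eventually_ncard_BADset_le (H : HypAction S ρ x0 φ δ E0) (hlox : IsLoxodromic ρ x0 φ)
    (hNVC : NonVirtuallyCyclic G) {L : ℕ} (hL : 0 < L)
    (hD : 10000 * (E0 + δ) ≤ orbDist ρ x0 1 (φ ^ L)) {K : ℕ}
    (hK : ∀ g h : G, orbDist ρ x0 g h ≤ K * wordLength S (g⁻¹ * h))
    (hDK : 8 * (K : ℝ) + 4 ≤ orbDist ρ x0 1 (φ ^ L)) {Υ : GeodesicSegment X}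
    (hi : Υ.initial = x0) (ht : Υ.terminal = ρ (φ ^ L) x0) (hisom : ∀ g : G, Isometry (ρ g))
    {ε : ℝ} (hε : 0 < ε) : ∀ᶠ n : ℕ in Filter.atTop,
      ((BADset S ρ hisom x0 δ E0 Υ ε n).ncard : ℝ) / ((ball S (n : ℝ)).ncard : ℝ) ≤
        25 * ε * (ball S (E0 + 2 * (L : ℝ) * (wordLength S φ : ℝ))).ncard *
          (ball S ((L * wordLength S φ + 4 : ℕ) : ℝ)).ncard := by
  have p0 := H.E0_pos
  have p1 := H.pos
  have hK0 : (0 : ℝ) ≤ K := Nat.cast_nonneg K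
  obtain ⟨C, -, hC⟩ := H.exists_crossed_bound hL p0.le (by linarith) (by linarith)
  obtain ⟨C', hC'⟩ := H.exists_ncard_manyInsertions_le hL hD hK hDK hi ht hisom
  have hlim := (H.tendsto_pow_div_ncard_ball hlox hNVC 5 (half_pos hε)).const_mul
    (3 * 32 * (C : ℝ) * C')
  rw [mul_zero] at hlim
  set c := L * wordLength S φ + 2 with hc
  set R := (ball S (E0 + 2 * (L : ℝ) * (wordLength S φ : ℝ))).ncard with hR'
  set k := (ball S ((L * wordLength S φ + 4 : ℕ) : ℝ)).ncard with hk
  have hR : (1 : ℝ) ≤ R := by exact_mod_cast one_le_ncard_ball H.gen (by positivity)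
  have hk1 : (1 : ℝ) ≤ k := by exact_mod_cast one_le_ncard_ball H.gen (Nat.cast_nonneg _)
  have hev := (tendsto_natCast_atTop_atTop (R := ℝ)).const_mul_atTop hε
  filter_upwards [hlim.eventually_lt_const one_pos, hev.eventually_ge_atTop 1,
    (tendsto_natCast_atTop_atTop (R := ℝ)).eventually_ge_atTop (10 * (c + 1)),
    Filter.eventually_gt_atTop 0] with n h1 h2 h3 h4
  set m := ⌈ε * (n : ℝ)⌉₊ with hm
  set e := ⌊ε / 2 * (n : ℝ)⌋₊ with he
  set B := BADset S ρ hisom x0 δ E0 Υ ε n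
  have hm0 : 0 < m := Nat.ceil_pos.2 (by linarith)
  have hem : 2 * e ≤ m := by
    have h5 : (e : ℝ) ≤ ε / 2 * n := Nat.floor_le (by positivity)
    have h6 : ε * n ≤ (m : ℝ) := Nat.le_ceil _
    have h7 : ((2 * e : ℕ) : ℝ) ≤ m := by push_cast; linarith
    exact_mod_cast h7
  have hcard := H.ncard_mul_le hL (n := n) (N := ⌊(0.9 : ℝ) * (n : ℝ)⌋₊ - c) (M := 2 * m + 2)
    (C := C * (n + 1)) (B := B) (fun u hu => hC n 1 u (by simpa using hu)) (fun g hg => by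
      have h5 := mem_ball_natCast.1 hg.1
      have h6 := not_le.1 fun h => hg.2 (Or.inl (mem_ball_natCast.2 h))
      have h7 : c ≤ ⌊(0.9 : ℝ) * (n : ℝ)⌋₊ := Nat.le_floor (by linarith)
      exact ⟨h5, by omega⟩)
  have hmany := hC' ε n m e hm.symm hm0 hem
  rw [← hk, ← hR'] at hcard
  set N := ⌊(0.9 : ℝ) * (n : ℝ)⌋₊ - c
  set T := (manyInsertions S ρ x0 φ E0 L n B (2 * m + 2 + 1)).ncard
  have hN : (0.8 : ℝ) * n ≤ N := by
    have h5 := Nat.lt_floor_add_one ((0.9 : ℝ) * (n : ℝ))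
    have h6 : (⌊(0.9 : ℝ) * (n : ℝ)⌋₊ : ℝ) - c ≤ N := by
      rw [sub_le_iff_le_add]
      exact_mod_cast (by omega : ⌊(0.9 : ℝ) * (n : ℝ)⌋₊ ≤ N + c)
    linarith
  have hb0 : (1 : ℝ) ≤ (ball S (n : ℝ)).ncard := by
    exact_mod_cast one_le_ncard_ball H.gen (Nat.cast_nonneg _)
  have hbe : (1 : ℝ) ≤ (ball S (e : ℝ)).ncard := by
    exact_mod_cast one_le_ncard_ball H.gen (Nat.cast_nonneg _)
  have hcard' : (B.ncard : ℝ) * N ≤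
      ((ball S (n : ℝ)).ncard * ((2 * m + 2) * R) + T * (C * (n + 1))) * (k * 3) := by
    exact_mod_cast hcard
  have hmany' : (T : ℝ) * (ball S (e : ℝ)).ncard ≤ C' * (n + 2) ^ 4 * (ball S (n : ℝ)).ncard := by
    exact_mod_cast hmany
  set b : ℝ := ((ball S (n : ℝ)).ncard : ℝ)
  set be : ℝ := ((ball S (e : ℝ)).ncard : ℝ)
  have hT : 3 * (T * (C * (n + 1))) ≤ b := by
    rw [mul_div_assoc', div_lt_one (by linarith)] at h1
    have h5 : ((n : ℝ) + 2) ^ 4 ≤ 32 * (n + 1) ^ 4 := by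
      have h6 : ((n : ℝ) + 2) ^ 4 ≤ (2 * (n + 1)) ^ 4 := by gcongr; linarith
      have h7 : (0 : ℝ) ≤ (n + 1) ^ 4 := by positivity
      rw [mul_pow] at h6
      linarith
    refine le_of_mul_le_mul_right ?_ (by linarith : 0 < be)
    calc 3 * (T * (C * (n + 1))) * be = 3 * C * (n + 1) * (T * be) := by ring
      _ ≤ 3 * C * (n + 1) * (C' * (n + 2) ^ 4 * b) := by gcongr
      _ ≤ 3 * C * (n + 1) * (C' * (32 * (n + 1) ^ 4) * b) := by gcongr
      _ = (3 * 32 * C * C' * (n + 1) ^ 5) * b := by ring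
      _ ≤ be * b := by gcongr
      _ = b * be := mul_comm _ _
  have hm' : (m : ℝ) < ε * n + 1 := Nat.ceil_lt_add_one (by positivity)
  have hn0 : (0 : ℝ) < n := by exact_mod_cast h4
  rw [div_le_iff₀ (by linarith)]
  refine le_of_mul_le_mul_right ?_ (by linarith : (0 : ℝ) < N)
  calc (B.ncard : ℝ) * N ≤ (b * ((2 * m + 2) * R) + T * (C * (n + 1))) * (k * 3) := hcard'
    _ = b * ((2 * m + 2) * R) * (k * 3) + 3 * (T * (C * (n + 1))) * k := by ring
    _ ≤ b * ((6 * (ε * n)) * R) * (k * 3) + (b * (2 * (ε * n) * R)) * k := by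
      refine add_le_add ?_ (mul_le_mul_of_nonneg_right (hT.trans ?_) (by linarith))
      · gcongr
        linarith
      · rw [mul_assoc]
        exact le_mul_of_one_le_right (by linarith) (by nlinarith)
    _ = 20 * (ε * b * R * k * n) := by ring
    _ ≤ 25 * (ε * b * R * k * (0.8 * n)) := by linarith
    _ ≤ 25 * (ε * b * R * k * N) := by gcongr
    _ = _ := by ring

end HypAction

/-- Lemma 4.3: the asymptotic density of `BAD_{L,ε}(n)` is small. -/
theorem bad_density {G : Type*} [Group G] {X : Type*} [MetricSpace X]
    (S : Finset G) (hSgen : Subgroup.closure (S : Set G) = ⊤)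
    (hNVC : NonVirtuallyCyclic G)
    (δ : ℝ) (hδ : 0 < δ) (hgeo : IsGeodesicSpace X) (hhyp : IsDeltaHyperbolic X δ)
    (ρ : G → X → X) (hisom : ∀ g : G, Isometry (ρ g))
    (hmul : ∀ g h : G, ∀ x : X, ρ (g * h) x = ρ g (ρ h x)) (hone : ∀ x : X, ρ 1 x = x)
    (x0 : X) (φ : G)
    (hlox : IsLoxodromic ρ x0 φ) (hwpd : HasWPD ρ x0 φ)
    (E0 : ℝ) (hE0 : E0Spec S ρ x0 φ E0) :
    ∃ L1 : ℝ, 0 < L1 ∧ ∀ L : ℕ, L1 < (L : ℝ) →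
      ∀ Υ : GeodesicSegment X, Υ.initial = x0 → Υ.terminal = ρ (φ ^ L) x0 →
      ∀ ε : ℝ, 0 < ε →
        Filter.limsup (fun n : ℕ =>
            ((BADset S ρ hisom x0 δ E0 Υ ε n).ncard : ℝ) / ((ball S (n:ℝ)).ncard : ℝ))
          Filter.atTop
          ≤ 5 * ε * (2 * E0 + 4 * (L : ℝ) * (wordLength S φ : ℝ) + 5) *
            ((ball S (E0 + 2 * (L : ℝ) * (wordLength S φ : ℝ))).ncard : ℝ) *
            ((ball S ((wordLength S φ : ℝ) * (L : ℝ) + 4)).ncard : ℝ) := by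
  have H : HypAction S ρ x0 φ δ E0 := ⟨hSgen, hδ, hgeo, hhyp, hisom, hmul, hone, hE0⟩
  have p0 := H.E0_pos
  obtain ⟨K, -, hK⟩ := H.exists_lipschitz
  obtain ⟨L0, hL0⟩ := Filter.eventually_atTop.1
    (((H.tendsto_orbDist_pow hlox).eventually_ge_atTop (10000 * (E0 + δ))).and
      ((H.tendsto_orbDist_pow hlox).eventually_ge_atTop (8 * (K : ℝ) + 4)))
  refine ⟨L0 + 1, by positivity, fun L hL Υ hi ht ε hε => ?_⟩
  have hL' : L0 + 1 < L := by exact_mod_cast hL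
  obtain ⟨hD, hDK⟩ := hL0 L (by omega)
  refine Filter.limsup_le_of_le ?_ ((H.eventually_ncard_BADset_le hlox hNVC (by omega) hD hK hDK hi
    ht hisom hε).mono fun n hn => hn.trans ?_)
  · exact Filter.IsCoboundedUnder.of_frequently_ge (a := 0)
      (Filter.Frequently.of_forall fun n => by positivity)
  · have e : ((L * wordLength S φ + 4 : ℕ) : ℝ) = (wordLength S φ : ℝ) * (L : ℝ) + 4 := by
      push_cast; ring
    have h1 : 25 * ε ≤ 5 * ε * (2 * E0 + 4 * (L : ℝ) * (wordLength S φ : ℝ) + 5) := by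
      have h2 : (0 : ℝ) ≤ 2 * E0 + 4 * (L : ℝ) * (wordLength S φ : ℝ) := by positivity
      nlinarith
    rw [e]
    gcongr

end AcylCount
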